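/- arXiv:2509.17502 — 8 statements merged into one kernel-verified Lean document; each statement's English description precedes it below -/
import Mathlib

section
/- Let H be a finite simple graph with no isolated vertices and at least one edge. Then for every integer m ≥ 1 and every finite simple graph G with exactly m edges, c(G,H) ≤ 2^{|V(H)|/2} · |Aut(H)|^{-1} · m^{α_f(H)}. -/
open SimpleGraph

/-- Number of induced copies of `H` in `G`: vertex subsets of `G` whose induced
subgraph is isomorphic to `H`. -/
noncomputable def inducedCopies {V W : Type*} [Fintype V] [Fintype W]
    (G : SimpleGraph V) (H : SimpleGraph W) : ℕ :=
  {S : Finset V | Nonempty ((G.induce (S : Set V)) ≃g H)}.ncard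

/-- The fractional independence number of a finite simple graph `H`. -/
noncomputable def fracIndepNum {V : Type*} [Fintype V] (H : SimpleGraph V) : ℝ :=
  sSup {x : ℝ | ∃ ω : V → ℝ, (∀ v, 0 ≤ ω v ∧ ω v ≤ 1) ∧
    (∀ u v, H.Adj u v → ω u + ω v ≤ 1) ∧ x = ∑ v, ω v}

/-- The set of vertices adjacent to at least one vertex of `S`. -/
def finNbhd {V : Type*} [Fintype V] (H : SimpleGraph V) [DecidableRel H.Adj]
    (S : Finset V) : Finset V :=
  Finset.univ.filter (fun v => ∃ u ∈ S, H.Adj u v)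

open Classical in
/-- If every coordinate is determined by at least two of the maps `π j`, then the square of the
size of a finite family is at most the product of the sizes of its images. -/
theorem card_sq_le_prod_card_image {R V J X : Type*} [Fintype R] [Fintype J]
    (π : J → (R → V) → X)
    (hcov : ∀ a, ∃ i j, i ≠ j ∧ (∀ f g, π i f = π i g → f a = g a) ∧
      (∀ f g, π j f = π j g → f a = g a))
    (F : Finset (R → V)) : F.card ^ 2 ≤ ∏ j, (F.image (π j)).card := by
  suffices key : ∀ (U : Finset R) (F : Finset (R → V)),
      (∀ f ∈ F, ∀ g ∈ F, ∀ r, r ∉ U → f r = g r) →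
      F.card ^ 2 ≤ ∏ j, (F.image (π j)).card from
    key Finset.univ F fun f _ g _ r hr => absurd (Finset.mem_univ r) hr
  intro U
  induction U using Finset.induction_on with
  | empty =>
    intro F hF
    rcases F.eq_empty_or_nonempty with rfl | hne
    · simp
    · have h1 : F.card ≤ 1 := Finset.card_le_one.2 fun f hf g hg =>
        funext fun r => hF f hf g hg r (Finset.notMem_empty r)
      calc F.card ^ 2 ≤ 1 := pow_le_one₀ (Nat.zero_le _) h1
        _ ≤ ∏ j, (F.image (π j)).card :=
          Nat.one_le_iff_ne_zero.2 (Finset.prod_ne_zero_iff.2 fun j _ =>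
            (hne.image (π j)).card_pos.ne')
  | insert a U _ ih =>
    intro F hF
    obtain ⟨i, j, hij, hi, hj⟩ := hcov a
    set B := F.image (fun f => f a)
    let Fx : V → Finset (R → V) := fun x => F.filter (fun f => f a = x)
    have hsum : F.card = ∑ x ∈ B, (Fx x).card :=
      Finset.card_eq_sum_card_image (fun f => f a) F
    have hslice : ∀ k, (∀ f g, π k f = π k g → f a = g a) →
        ∑ x ∈ B, ((Fx x).image (π k)).card ≤ (F.image (π k)).card := by
      intro k hk
      rw [← Finset.card_biUnion]
      · apply Finset.card_le_card
        intro y hy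
        simp only [Finset.mem_biUnion, Finset.mem_image, Fx, Finset.mem_filter] at hy ⊢
        obtain ⟨x, _, f, ⟨hf, _⟩, rfl⟩ := hy
        exact ⟨f, hf, rfl⟩
      · intro x _ y _ hxy
        rw [Function.onFun, Finset.disjoint_left]
        intro z hz hz'
        simp only [Finset.mem_image, Fx, Finset.mem_filter] at hz hz'
        obtain ⟨f, ⟨_, rfl⟩, rfl⟩ := hz
        obtain ⟨g, ⟨_, rfl⟩, hg⟩ := hz'
        exact hxy (hk _ _ hg.symm)
    have hsplit : ∀ c : J → ℕ, ∏ k, c k = (∏ k ∈ (Finset.univ.erase i).erase j, c k) *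
        (c i * c j) := by
      intro c
      rw [← Finset.mul_prod_erase Finset.univ c (Finset.mem_univ i),
        ← Finset.mul_prod_erase (Finset.univ.erase i) c
          (Finset.mem_erase.2 ⟨hij.symm, Finset.mem_univ j⟩)]
      ring
    set C := ∏ k ∈ (Finset.univ.erase i).erase j, (F.image (π k)).card
    have hx : ∀ x ∈ B, (Fx x).card ^ 2 ≤
        (C * ((Fx x).image (π i)).card) * ((Fx x).image (π j)).card := by
      intro x _
      refine (ih (Fx x) ?_).trans ?_
      · intro f hf g hg r hr
        simp only [Fx, Finset.mem_filter] at hf hg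
        by_cases hra : r = a
        · rw [hra, hf.2, hg.2]
        · exact hF f hf.1 g hg.1 r (by simp [hra, hr])
      · rw [hsplit, mul_assoc]
        refine Nat.mul_le_mul_right _ (Finset.prod_le_prod' fun k _ => ?_)
        exact Finset.card_le_card (Finset.image_subset_image (Finset.filter_subset _ _))
    calc F.card ^ 2 = (∑ x ∈ B, (Fx x).card) ^ 2 := by rw [hsum]
      _ ≤ (∑ x ∈ B, C * ((Fx x).image (π i)).card) * ∑ x ∈ B, ((Fx x).image (π j)).card :=
        Finset.sum_sq_le_sum_mul_sum_of_sq_le_mul B (fun _ _ => Nat.zero_le _)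
          (fun _ _ => Nat.zero_le _) hx
      _ = C * ((∑ x ∈ B, ((Fx x).image (π i)).card) *
          ∑ x ∈ B, ((Fx x).image (π j)).card) := by
        rw [← Finset.mul_sum, mul_assoc]
      _ ≤ C * ((F.image (π i)).card * (F.image (π j)).card) := by
        gcongr
        · exact hslice i hi
        · exact hslice j hj
      _ = ∏ k, (F.image (π k)).card := (hsplit _).symm

open Classical in
theorem card_filter_adj_eq_two_mul {V : Type*} [Fintype V] (G : SimpleGraph V) :
    (Finset.univ.filter fun p : V × V => G.Adj p.1 p.2).card = 2 * G.edgeFinset.card := by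
  rw [← G.dart_card_eq_twice_card_edges, ← Fintype.card_subtype]
  exact Fintype.card_congr
    { toFun := fun p => ⟨p.1, p.2⟩
      invFun := fun d => ⟨d.toProd, d.adj⟩
      left_inv := fun _ => rfl
      right_inv := fun _ => rfl }

open Classical in
theorem card_filter_adj_comp_sq_le {R V : Type*} [Fintype R] [Fintype V] (G : SimpleGraph V)
    (σ : R → R) (hσ : Function.Injective σ) (hne : ∀ r, σ r ≠ r) :
    (Finset.univ.filter fun f : R → V => ∀ r, G.Adj (f r) (f (σ r))).card ^ 2 ≤
      (2 * G.edgeFinset.card) ^ Fintype.card R := by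
  refine (card_sq_le_prod_card_image (fun r f => (f r, f (σ r))) ?_ _).trans ?_
  · intro a
    obtain ⟨b, rfl⟩ := Finite.surjective_of_injective hσ a
    exact ⟨σ b, b, hne b, fun f g h => (Prod.ext_iff.1 h).1, fun f g h => (Prod.ext_iff.1 h).2⟩
  · rw [← Finset.card_univ, ← Finset.prod_const, ← card_filter_adj_eq_two_mul]
    refine Finset.prod_le_prod' fun r _ => Finset.card_le_card fun p hp => ?_
    simp only [Finset.mem_image, Finset.mem_filter, Finset.mem_univ, true_and] at hp ⊢
    obtain ⟨f, hf, rfl⟩ := hp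
    exact hf r

open Classical in
/-- A set maximizing `|S| - |N(S)|` splits the vertices of a graph into an independent set `S`, its
neighbourhood `N`, which is matched into `S`, and a remainder that is covered by disjoint edges
and cycles. -/
theorem exists_matching_decomposition {W : Type*} [Fintype W] (H : SimpleGraph W) :
    ∃ S N : Finset W, Disjoint S N ∧ (∀ u ∈ S, ∀ v, H.Adj u v → v ∈ N) ∧
      (∃ ψ : N → W, Function.Injective ψ ∧ ∀ u, ψ u ∈ S ∧ H.Adj u (ψ u)) ∧
      ∃ σ : {w // w ∉ S ∧ w ∉ N} → {w // w ∉ S ∧ w ∉ N},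
        Function.Injective σ ∧ ∀ r, H.Adj r.1 (σ r).1 := by
  have mem_nb : ∀ (S : Finset W) v, v ∈ finNbhd H S ↔ ∃ u ∈ S, H.Adj u v := by
    simp [finNbhd]
  obtain ⟨S₀, -, hmax₀⟩ := Finset.exists_max_image (Finset.univ : Finset (Finset W))
    (fun S => (S.card : ℤ) - (finNbhd H S).card) ⟨∅, Finset.mem_univ _⟩
  obtain ⟨S, hdisj, hmax⟩ : ∃ S : Finset W, Disjoint S (finNbhd H S) ∧
      ∀ T : Finset W, (T.card : ℤ) - (finNbhd H T).card ≤ S.card - (finNbhd H S).card := by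
    refine ⟨S₀ \ finNbhd H S₀, ?_, fun T => (hmax₀ T (Finset.mem_univ T)).trans ?_⟩
    · rw [Finset.disjoint_left]
      intro v hv hv'
      rw [mem_nb] at hv'
      obtain ⟨u, hu, huv⟩ := hv'
      rw [Finset.mem_sdiff] at hu hv
      exact hv.2 ((mem_nb _ _).2 ⟨u, hu.1, huv⟩)
    · have hsub : finNbhd H (S₀ \ finNbhd H S₀) ⊆ finNbhd H S₀ \ S₀ := by
        intro v hv
        rw [mem_nb] at hv
        obtain ⟨u, hu, huv⟩ := hv
        rw [Finset.mem_sdiff] at hu ⊢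
        exact ⟨(mem_nb _ _).2 ⟨u, hu.1, huv⟩,
          fun hvS => hu.2 ((mem_nb _ _).2 ⟨v, hvS, huv.symm⟩)⟩
      have h1 := Finset.card_le_card hsub
      have h2 := Finset.card_sdiff_add_card_inter S₀ (finNbhd H S₀)
      have h3 := Finset.card_sdiff_add_card_inter (finNbhd H S₀) S₀
      rw [Finset.inter_comm] at h3
      omega
  refine ⟨S, finNbhd H S, hdisj, fun u hu v huv => (mem_nb _ _).2 ⟨u, hu, huv⟩, ?_, ?_⟩
  · obtain ⟨ψ, hψ, hmem⟩ := (Finset.all_card_le_biUnion_card_iff_exists_injective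
      (fun u : finNbhd H S => S.filter (fun s => H.Adj u s))).1 (by
        intro T
        by_contra! hlt
        set P := T.biUnion (fun u : finNbhd H S => S.filter (fun s => H.Adj u s))
        have hPS : P ⊆ S := Finset.biUnion_subset.2 fun u _ => Finset.filter_subset _ _
        have hsub : finNbhd H (S \ P) ⊆ finNbhd H S \ T.map (Function.Embedding.subtype _) := by
          intro v hv
          obtain ⟨u, hu, huv⟩ := (mem_nb _ _).1 hv
          rw [Finset.mem_sdiff] at hu ⊢
          refine ⟨(mem_nb _ _).2 ⟨u, hu.1, huv⟩, fun hvT => hu.2 ?_⟩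
          obtain ⟨t, ht, rfl⟩ := Finset.mem_map.1 hvT
          exact Finset.mem_biUnion.2 ⟨t, ht, Finset.mem_filter.2 ⟨hu.1, huv.symm⟩⟩
        have hTN : T.map (Function.Embedding.subtype _) ⊆ finNbhd H S := by
          intro v hv
          obtain ⟨t, _, rfl⟩ := Finset.mem_map.1 hv
          exact t.2
        have h1 := Finset.card_le_card hsub
        rw [Finset.card_sdiff_of_subset hTN, Finset.card_map] at h1
        have h2 := Finset.card_sdiff_of_subset hPS
        have h3 := Finset.card_le_card hPS
        have h4 := Finset.card_le_card hTN
        rw [Finset.card_map] at h4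
        have h5 := hmax (S \ P)
        omega)
    exact ⟨ψ, hψ, fun u => Finset.mem_filter.1 (hmem u)⟩
  · obtain ⟨σ, hσ, hmem⟩ := (Finset.all_card_le_biUnion_card_iff_exists_injective
      (fun r : {w // w ∉ S ∧ w ∉ finNbhd H S} =>
        (Finset.univ : Finset {w // w ∉ S ∧ w ∉ finNbhd H S}).filter
          (fun s => H.Adj r.1 s.1))).1 (by
        intro T
        by_contra! hlt
        set P := T.biUnion (fun r : {w // w ∉ S ∧ w ∉ finNbhd H S} =>
          (Finset.univ : Finset {w // w ∉ S ∧ w ∉ finNbhd H S}).filter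
          (fun s => H.Adj r.1 s.1))
        have hsub : finNbhd H (S ∪ T.map (Function.Embedding.subtype _)) ⊆
            finNbhd H S ∪ P.map (Function.Embedding.subtype _) := by
          intro v hv
          obtain ⟨u, hu, huv⟩ := (mem_nb _ _).1 hv
          rw [Finset.mem_union] at hu ⊢
          by_cases hvN : v ∈ finNbhd H S
          · exact Or.inl hvN
          · right
            rcases hu with hu | hu
            · exact absurd ((mem_nb _ _).2 ⟨u, hu, huv⟩) hvN
            · obtain ⟨t, ht, rfl⟩ := Finset.mem_map.1 hu
              have hvS : v ∉ S := fun hvS => t.2.2 ((mem_nb _ _).2 ⟨v, hvS, huv.symm⟩)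
              exact Finset.mem_map.2 ⟨⟨v, hvS, hvN⟩, Finset.mem_biUnion.2
                ⟨t, ht, Finset.mem_filter.2 ⟨Finset.mem_univ _, huv⟩⟩, rfl⟩
        have hd : Disjoint S (T.map (Function.Embedding.subtype _)) := by
          rw [Finset.disjoint_left]
          intro v hv hv'
          obtain ⟨t, _, rfl⟩ := Finset.mem_map.1 hv'
          exact t.2.1 hv
        have h1 := (Finset.card_le_card hsub).trans (Finset.card_union_le _ _)
        have h2 := Finset.card_union_of_disjoint hd
        rw [Finset.card_map] at h1 h2
        have h3 := hmax (S ∪ T.map (Function.Embedding.subtype _))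
        omega)
    exact ⟨σ, hσ, fun r => (Finset.mem_filter.1 (hmem r)).2⟩

theorem card_add_card_sub_card_div_two_le_fracIndepNum {W : Type*} [Fintype W]
    (H : SimpleGraph W) (S N : Finset W) (hd : Disjoint S N)
    (hN : ∀ u ∈ S, ∀ v, H.Adj u v → v ∈ N) :
    ((Fintype.card W : ℝ) + S.card - N.card) / 2 ≤ fracIndepNum H := by
  classical
  refine le_csSup ⟨Fintype.card W, ?_⟩
    ⟨fun w => (1 + (if w ∈ S then 1 else 0) - (if w ∈ N then 1 else 0)) / 2, ?_, ?_, ?_⟩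
  · rintro x ⟨ω, h01, -, rfl⟩
    calc ∑ v, ω v ≤ ∑ _v : W, (1 : ℝ) := Finset.sum_le_sum fun v _ => (h01 v).2
      _ = Fintype.card W := by simp
  · intro v
    have : v ∈ S → v ∉ N := fun h => Finset.disjoint_left.1 hd h
    dsimp only
    split_ifs <;> constructor <;> norm_num
  · intro u v huv
    have h1 : u ∈ S → u ∉ N := fun h => Finset.disjoint_left.1 hd h
    have h2 : v ∈ S → v ∉ N := fun h => Finset.disjoint_left.1 hd h
    have h3 := fun h => hN u h v huv
    have h4 := fun h => hN v h u huv.symm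
    dsimp only
    split_ifs <;> first | norm_num; done | grind
  · rw [← Finset.sum_div, Finset.sum_sub_distrib, Finset.sum_add_distrib]
    simp

open Classical in
theorem exists_card_filter_hom_sq_le {W V : Type*} [Fintype W] [Fintype V]
    (H : SimpleGraph W) (G : SimpleGraph V) (hni : ∀ v : W, ∃ u, H.Adj v u) :
    ∃ S N : Finset W, Disjoint S N ∧ (∀ u ∈ S, ∀ v, H.Adj u v → v ∈ N) ∧ N.card ≤ S.card ∧
      (Finset.univ.filter fun f : W → V => ∀ u v, H.Adj u v → G.Adj (f u) (f v)).card ^ 2 ≤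
        2 ^ Fintype.card W * G.edgeFinset.card ^ (Fintype.card W + S.card - N.card) := by
  obtain ⟨S, N, hd, hN, ⟨ψ, hψ, hψS⟩, σ, hσ, hσH⟩ := exists_matching_decomposition H
  choose p hp using hni
  set m := G.edgeFinset.card
  set F := Finset.univ.filter fun f : W → V => ∀ u v, H.Adj u v → G.Adj (f u) (f v)
  set FR := Finset.univ.filter fun f : {w // w ∉ S ∧ w ∉ N} → V =>
    ∀ r, G.Adj (f r) (f (σ r)) with hFR
  set Q := S \ Finset.univ.image ψ
  have hψsub : Finset.univ.image ψ ⊆ S := by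
    intro v hv
    obtain ⟨u, -, rfl⟩ := Finset.mem_image.1 hv
    exact (hψS u).1
  have hψcard : (Finset.univ.image ψ).card = N.card := by
    rw [Finset.card_image_of_injective _ hψ, Finset.card_univ, Fintype.card_coe]
  have hQcard : Q.card + N.card = S.card := by
    rw [← hψcard, Finset.card_sdiff_add_card_eq_card hψsub]
  have hRcard : Fintype.card {w // w ∉ S ∧ w ∉ N} + (S.card + N.card) = Fintype.card W := by
    rw [← Finset.card_union_of_disjoint hd, Fintype.card_subtype,
      ← Finset.card_compl_add_card (S ∪ N)]
    congr 2
    ext w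
    simp
  have hRsq : FR.card ^ 2 ≤ (2 * m) ^ Fintype.card {w // w ∉ S ∧ w ∉ N} := by
    convert card_filter_adj_comp_sq_le G σ hσ
      fun r h => (hσH r).ne (congrArg Subtype.val h).symm
  have hcount : F.card ≤ FR.card * ((2 * m) ^ N.card * m ^ Q.card) := by
    have hle : F.card ≤ (FR ×ˢ ((Fintype.piFinset fun _ : N =>
        Finset.univ.filter fun p : V × V => G.Adj p.1 p.2) ×ˢ
        (Fintype.piFinset fun _ : Q => G.edgeFinset))).card := by
      refine Finset.card_le_card_of_injOn
        (fun f => (fun r => f r, fun u => (f u, f (ψ u)), fun s => s(f s, f (p s)))) ?_ ?_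
      · intro f hf
        replace hf := (Finset.mem_filter.1 (Finset.mem_coe.1 hf)).2
        simp only [Finset.mem_coe, Finset.mem_product, hFR, Finset.mem_filter, Finset.mem_univ,
          true_and, Fintype.mem_piFinset, mem_edgeFinset, mem_edgeSet]
        exact ⟨fun r => hf _ _ (hσH r), fun u => hf _ _ (hψS u).2, fun s => hf _ _ (hp s)⟩
      · intro f _ g _ hfg
        simp only [Prod.mk.injEq] at hfg
        obtain ⟨h1, h2, h3⟩ := hfg
        have hNeq : ∀ u ∈ N, f u = g u := fun u hu =>
          (Prod.ext_iff.1 (congrFun h2 ⟨u, hu⟩)).1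
        funext w
        by_cases hwN : w ∈ N
        · exact hNeq w hwN
        by_cases hwS : w ∈ S
        · by_cases hwψ : w ∈ Finset.univ.image ψ
          · obtain ⟨u, -, rfl⟩ := Finset.mem_image.1 hwψ
            exact (Prod.ext_iff.1 (congrFun h2 u)).2
          · have h := congrFun h3 ⟨w, Finset.mem_sdiff.2 ⟨hwS, hwψ⟩⟩
            simp only [hNeq (p w) (hN w hwS _ (hp w))] at h
            exact Sym2.congr_left.1 h
        · exact congrFun h1 ⟨w, hwS, hwN⟩
    simpa [Finset.card_product, Fintype.card_piFinset, card_filter_adj_eq_two_mul] using hle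
  refine ⟨S, N, hd, hN, by omega, ?_⟩
  calc F.card ^ 2 ≤ (FR.card * ((2 * m) ^ N.card * m ^ Q.card)) ^ 2 :=
          Nat.pow_le_pow_left hcount 2
      _ = FR.card ^ 2 * ((2 * m) ^ N.card * m ^ Q.card) ^ 2 := mul_pow _ _ _
      _ ≤ (2 * m) ^ Fintype.card {w // w ∉ S ∧ w ∉ N} *
          ((2 * m) ^ N.card * m ^ Q.card) ^ 2 := Nat.mul_le_mul_right _ hRsq
      _ = 2 ^ (Fintype.card {w // w ∉ S ∧ w ∉ N} + 2 * N.card) *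
          m ^ (Fintype.card W + S.card - N.card) := by
        have : Fintype.card W + S.card - N.card =
            Fintype.card {w // w ∉ S ∧ w ∉ N} + 2 * N.card + 2 * Q.card := by omega
        rw [this]
        ring
      _ ≤ 2 ^ Fintype.card W * m ^ (Fintype.card W + S.card - N.card) := by
        gcongr
        all_goals omega

open Classical in
theorem card_filter_hom_le {W V : Type*} [Fintype W] [Fintype V]
    (H : SimpleGraph W) (G : SimpleGraph V) (hni : ∀ v : W, ∃ u, H.Adj v u)
    (hm : 1 ≤ G.edgeFinset.card) :
    ((Finset.univ.filter fun f : W → V => ∀ u v, H.Adj u v → G.Adj (f u) (f v)).card : ℝ) ≤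
      (2 : ℝ) ^ ((Fintype.card W : ℝ) / 2) * (G.edgeFinset.card : ℝ) ^ fracIndepNum H := by
  obtain ⟨S, N, hd, hN, hNS, hsq⟩ := exists_card_filter_hom_sq_le H G hni
  have hfrac := card_add_card_sub_card_div_two_le_fracIndepNum H S N hd hN
  set m := G.edgeFinset.card
  set F := Finset.univ.filter fun f : W → V => ∀ u v, H.Adj u v → G.Adj (f u) (f v)
  have hm0 : (0 : ℝ) < m := by exact_mod_cast hm
  have hm1 : (1 : ℝ) ≤ m := by exact_mod_cast hm
  have hcast : ((Fintype.card W + S.card - N.card : ℕ) : ℝ) =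
      (Fintype.card W : ℝ) + S.card - N.card := by
    rw [Nat.cast_sub (by omega)]
    push_cast
    ring
  have hreal : (F.card : ℝ) ≤ (2 : ℝ) ^ ((Fintype.card W : ℝ) / 2) *
      (m : ℝ) ^ (((Fintype.card W : ℝ) + S.card - N.card) / 2) := by
    refine le_of_sq_le_sq ?_ (by positivity)
    rw [mul_pow, ← Real.rpow_mul_natCast (by norm_num), ← Real.rpow_mul_natCast hm0.le]
    simp only [Nat.cast_ofNat, div_mul_cancel_of_invertible]
    rw [← hcast, Real.rpow_natCast, Real.rpow_natCast]
    exact_mod_cast hsq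
  refine hreal.trans ?_
  gcongr

open Classical in
theorem inducedCopies_mul_card_aut_le {W V : Type*} [Fintype W] [Fintype V]
    (H : SimpleGraph W) (G : SimpleGraph V) :
    inducedCopies G H * Nat.card (H ≃g H) ≤
      (Finset.univ.filter fun f : W → V => ∀ u v, H.Adj u v → G.Adj (f u) (f v)).card := by
  let C : Set (Finset V) := {S | Nonempty ((G.induce (S : Set V)) ≃g H)}
  let e : ∀ S : C, (G.induce (S.1 : Set V)) ≃g H := fun S => Classical.choice S.2
  have hcopies : inducedCopies G H = Nat.card C := (Nat.card_coe_set_eq C).symm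
  rw [hcopies, ← Nat.card_prod, ← Fintype.card_subtype, ← Nat.card_eq_fintype_card]
  refine Nat.card_le_card_of_injective
    (fun q : C × (H ≃g H) => ⟨fun w => ((e q.1).symm (q.2 w)).1, fun u v huv =>
      (e q.1).symm.map_rel_iff.2 (q.2.map_rel_iff.2 huv)⟩) ?_
  rintro ⟨S, α⟩ ⟨T, β⟩ h
  have hval : ∀ w, ((e S).symm (α w)).1 = ((e T).symm (β w)).1 := congrFun (congrArg Subtype.val h)
  have hST : S = T := by
    refine Subtype.ext (Finset.ext fun x => ⟨fun hx => ?_, fun hx => ?_⟩)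
    · have := hval (α.symm (e S ⟨x, hx⟩))
      simp only [RelIso.apply_symm_apply, RelIso.symm_apply_apply] at this
      rw [this]
      exact ((e T).symm _).2
    · have := hval (β.symm (e T ⟨x, hx⟩))
      simp only [RelIso.apply_symm_apply, RelIso.symm_apply_apply] at this
      rw [← this]
      exact ((e S).symm _).2
  subst hST
  exact Prod.ext rfl (RelIso.ext fun w => (e S).symm.injective (Subtype.ext (hval w)))

theorem edge_inducibility_upper_bound {W V : Type*} [Fintype W] [Fintype V]
    (H : SimpleGraph W)
    (hni : ∀ v : W, ∃ u, H.Adj v u) (hne : H.edgeSet.Nonempty)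
    (m : ℕ) (hm : 1 ≤ m) (G : SimpleGraph V) (hG : G.edgeSet.ncard = m) :
    (inducedCopies G H : ℝ) ≤
      (2 : ℝ) ^ ((Fintype.card W : ℝ) / 2) * (Nat.card (H ≃g H) : ℝ)⁻¹ *
        (m : ℝ) ^ fracIndepNum H := by
  classical
  have hcard : G.edgeFinset.card = m := by
    rw [← hG, ← Set.ncard_coe_finset, coe_edgeFinset]
  subst hcard
  have hpos : (0 : ℝ) < Nat.card (H ≃g H) := by
    have : Nonempty (H ≃g H) := ⟨Iso.refl⟩
    have : Finite (H ≃g H) := Finite.of_injective (fun e => (e : W → W)) DFunLike.coe_injective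
    exact_mod_cast Nat.card_pos
  have h1 : (inducedCopies G H : ℝ) * Nat.card (H ≃g H) ≤
      (Finset.univ.filter fun f : W → V => ∀ u v, H.Adj u v → G.Adj (f u) (f v)).card := by
    exact_mod_cast inducedCopies_mul_card_aut_le H G
  rw [mul_right_comm, ← div_eq_mul_inv, le_div_iff₀ hpos]
  exact h1.trans (card_filter_hom_le H G hni hm)
end

section
/- Let H be a finite simple graph with no isolated vertices and at least one edge. Then for every ε ∈ (0,1) there exists M such that for every integer m ≥ M there exists a finite simple graph G with at most m edges satisfying c(G,H) ≥ (1−ε) · (m/|E(H)|)^{α_f(H)}. -/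
open SimpleGraph

theorem exists_weight_sum_eq_fracIndepNum {V : Type*} [Fintype V] (H : SimpleGraph V) :
    ∃ ω : V → ℝ, (∀ v, 0 ≤ ω v ∧ ω v ≤ 1) ∧ (∀ u v, H.Adj u v → ω u + ω v ≤ 1) ∧
      fracIndepNum H = ∑ v, ω v := by
  let K : Set (V → ℝ) := Set.Icc 0 1 ∩ {ω | ∀ u v, H.Adj u v → ω u + ω v ≤ 1}
  have hclosed : IsClosed {ω : V → ℝ | ∀ u v, H.Adj u v → ω u + ω v ≤ 1} := by
    simp only [Set.ofPred_forall]
    refine isClosed_iInter fun u => isClosed_iInter fun v => isClosed_iInter fun _ => ?_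
    exact isClosed_le (by fun_prop) continuous_const
  have hK : IsCompact K := isCompact_Icc.inter_right hclosed
  have hne : K.Nonempty := ⟨0, ⟨le_rfl, zero_le_one⟩, fun u v _ => by simp⟩
  have hmem := (hK.image (f := fun ω : V → ℝ => ∑ v, ω v) (by fun_prop)).sSup_mem (hne.image _)
  have himage : {x : ℝ | ∃ ω : V → ℝ, (∀ v, 0 ≤ ω v ∧ ω v ≤ 1) ∧
      (∀ u v, H.Adj u v → ω u + ω v ≤ 1) ∧ x = ∑ v, ω v} =
      (fun ω : V → ℝ => ∑ v, ω v) '' K := by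
    ext x
    constructor
    · rintro ⟨ω, h, h', rfl⟩
      exact ⟨ω, ⟨⟨fun v => (h v).1, fun v => (h v).2⟩, h'⟩, rfl⟩
    · rintro ⟨ω, ⟨h, h'⟩, rfl⟩
      exact ⟨ω, fun v => ⟨h.1 v, h.2 v⟩, h', rfl⟩
  obtain ⟨ω, ⟨h, h'⟩, heq⟩ := hmem
  refine ⟨ω, fun v => ⟨h.1 v, h.2 v⟩, h', ?_⟩
  rw [fracIndepNum, himage]
  exact heq.symm

/-- A pullback of `H` along `f` has at most `k` edges over each edge of `H` if the products of
the sizes of the fibres over adjacent vertices are at most `k`. -/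
theorem ncard_edgeSet_comap_le {V W : Type*} [Fintype V] [Fintype W] (H : SimpleGraph W)
    (f : V → W) (k : ℕ)
    (hk : ∀ u v, H.Adj u v → Nat.card {x // f x = u} * Nat.card {x // f x = v} ≤ k) :
    (H.comap f).edgeSet.ncard ≤ k * H.edgeSet.ncard := by
  classical
  rw [Set.ncard_eq_toFinset_card', Set.ncard_eq_toFinset_card']
  refine Finset.card_le_mul_card_image_of_maps_to (f := Sym2.map f) ?_ k ?_
  · intro e
    induction e with
    | h x y => simp
  · intro e
    induction e with
    | h u v =>
      intro he
      have huv : H.Adj u v := by simpa using he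
      refine le_trans ?_ (hk u v huv)
      rw [Nat.card_eq_fintype_card, Nat.card_eq_fintype_card, Fintype.card_subtype,
        Fintype.card_subtype, ← Finset.card_product]
      refine le_trans (Finset.card_le_card ?_) (Finset.card_image_le (f := fun p => s(p.1, p.2)))
      intro e'
      induction e' with
      | h x y =>
        intro h
        simp only [Finset.mem_filter, Sym2.map_mk, Sym2.eq_iff] at h
        simp only [Finset.mem_image, Finset.mem_product, Finset.mem_filter, Finset.mem_univ,
          true_and, Prod.exists]
        rcases h.2 with ⟨hx, hy⟩ | ⟨hx, hy⟩
        · exact ⟨x, y, ⟨hx, hy⟩, rfl⟩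
        · exact ⟨y, x, ⟨hy, hx⟩, Sym2.eq_swap⟩

/-- Every section of `f` spans an induced copy of `H` in the pullback of `H` along `f`. -/
theorem prod_card_fiber_le_inducedCopies {V W : Type*} [Fintype V] [Fintype W]
    (H : SimpleGraph W) (f : V → W) :
    ∏ w, Nat.card {x // f x = w} ≤ inducedCopies (H.comap f) H := by
  classical
  rw [← Nat.card_pi, ← Set.ncard_univ, inducedCopies]
  refine Set.ncard_le_ncard_of_injOn
    (fun g : ∀ w, {x // f x = w} => Finset.univ.image fun w => (g w : V)) ?_ ?_ (Set.toFinite _)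
  · intro g _
    have hg : Function.Injective fun w => (g w : V) :=
      Function.LeftInverse.injective (g := f) fun w => (g w).2
    have hmem : ∀ x : V, x ∈ ((Finset.univ.image fun w => (g w : V) : Finset V) : Set V) →
        (g (f x) : V) = x := by
      intro x hx
      obtain ⟨w, -, rfl⟩ := Finset.mem_image.1 (Finset.mem_coe.1 hx)
      rw [(g w).2]
    exact ⟨{
      toFun := fun x => f x
      invFun := fun w => ⟨g w, by simp⟩
      left_inv := fun x => Subtype.ext (hmem x x.2)
      right_inv := fun w => (g w).2
      map_rel_iff' := by simp }⟩
  · intro g _ g' _ h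
    funext w
    have hw : (g w : V) ∈ Finset.univ.image fun w => (g' w : V) := by
      rw [← show (Finset.univ.image fun w => (g w : V)) = Finset.univ.image fun w => (g' w : V)
        from h]
      exact Finset.mem_image_of_mem _ (Finset.mem_univ w)
    obtain ⟨w', -, hw'⟩ := Finset.mem_image.1 hw
    have : w' = w := by rw [← (g' w').2, hw', (g w).2]
    subst this
    exact Subtype.ext hw'.symm

theorem tendsto_natFloor_rpow_div_rpow_atTop {a : ℝ} (ha : 0 ≤ a) :
    Filter.Tendsto (fun x : ℝ => (⌊x ^ a⌋₊ : ℝ) / x ^ a) Filter.atTop (nhds 1) := by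
  rcases ha.eq_or_lt with rfl | ha
  · simp
  · exact (tendsto_nat_floor_div_atTop (R := ℝ)).comp (tendsto_rpow_atTop ha)

theorem eventually_mul_rpow_sum_le_prod_natFloor {ι : Type*} [Fintype ι] (ω : ι → ℝ)
    (hω : ∀ i, 0 ≤ ω i) {ε : ℝ} (hε : 0 < ε) :
    ∀ᶠ x : ℝ in Filter.atTop, (1 - ε) * x ^ (∑ i, ω i) ≤ ∏ i, (⌊x ^ ω i⌋₊ : ℝ) := by
  have h : Filter.Tendsto (fun x : ℝ => ∏ i, (⌊x ^ ω i⌋₊ : ℝ) / x ^ ω i) Filter.atTop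
      (nhds 1) := by
    simpa using tendsto_finsetProd Finset.univ
      fun i _ => tendsto_natFloor_rpow_div_rpow_atTop (hω i)
  filter_upwards [h.eventually (lt_mem_nhds (show 1 - ε < 1 by linarith)),
    Filter.eventually_gt_atTop 0] with x hx hx0
  rw [Finset.prod_div_distrib, ← Real.rpow_sum_of_pos hx0] at hx
  exact ((lt_div_iff₀ (Real.rpow_pos_of_pos hx0 _)).1 hx).le

theorem natFloor_rpow_mul_natFloor_rpow_le {x a b : ℝ} (hx : 1 ≤ x) (hab : a + b ≤ 1) :
    ⌊x ^ a⌋₊ * ⌊x ^ b⌋₊ ≤ ⌊x⌋₊ := by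
  have hx0 : 0 < x := by linarith
  refine Nat.le_floor ?_
  push_cast
  calc (⌊x ^ a⌋₊ : ℝ) * ⌊x ^ b⌋₊ ≤ x ^ a * x ^ b := by
        gcongr <;> exact Nat.floor_le (by positivity)
    _ = x ^ (a + b) := (Real.rpow_add hx0 a b).symm
    _ ≤ x ^ (1 : ℝ) := Real.rpow_le_rpow_of_exponent_le hx hab
    _ = x := Real.rpow_one x

theorem edge_inducibility_lower_bound {W : Type*} [Fintype W] (H : SimpleGraph W)
    (hni : ∀ v : W, ∃ u, H.Adj v u) (hne : H.edgeSet.Nonempty)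
    (ε : ℝ) (hε : ε ∈ Set.Ioo (0 : ℝ) 1) :
    ∃ M : ℕ, ∀ m : ℕ, M ≤ m → ∃ (n : ℕ) (G : SimpleGraph (Fin n)),
      G.edgeSet.ncard ≤ m ∧
      (1 - ε) * ((m : ℝ) / (H.edgeSet.ncard : ℝ)) ^ fracIndepNum H ≤
        (inducedCopies G H : ℝ) := by
  obtain ⟨ω, hω, hadj, hsum⟩ := exists_weight_sum_eq_fracIndepNum H
  have he : 0 < H.edgeSet.ncard := (Set.ncard_pos (Set.toFinite _)).2 hne
  have htend : Filter.Tendsto (fun m : ℕ => (m : ℝ) / (H.edgeSet.ncard : ℝ)) Filter.atTop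
      Filter.atTop :=
    tendsto_natCast_atTop_atTop.atTop_div_const (by exact_mod_cast he)
  obtain ⟨M, hM⟩ := Filter.eventually_atTop.1 (htend.eventually
    ((eventually_mul_rpow_sum_le_prod_natFloor ω (fun v => (hω v).1) hε.1).and
      (Filter.eventually_ge_atTop 1)))
  refine ⟨M, fun m hm => ?_⟩
  obtain ⟨hprod, hx⟩ := hM m hm
  set x : ℝ := (m : ℝ) / (H.edgeSet.ncard : ℝ) with hxdef
  let e := (Fintype.equivFin (Σ v, Fin ⌊x ^ ω v⌋₊)).symm
  have hcard : ∀ v, Nat.card {i // (e i).1 = v} = ⌊x ^ ω v⌋₊ := by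
    intro v
    rw [Nat.card_congr ((e.subtypeEquiv fun _ => Iff.rfl).trans
      (Equiv.sigmaSubtype v) : {i // (e i).1 = v} ≃ Fin ⌊x ^ ω v⌋₊), Nat.card_fin]
  refine ⟨_, H.comap fun i => (e i).1, ?_, ?_⟩
  · refine (ncard_edgeSet_comap_le H _ (m / H.edgeSet.ncard) fun u v huv => ?_).trans
      (Nat.div_mul_le_self _ _)
    rw [hcard, hcard, ← Nat.floor_div_eq_div (K := ℝ)]
    exact natFloor_rpow_mul_natFloor_rpow_le hx (hadj u v huv)
  · rw [hsum]
    refine hprod.trans ?_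
    have h := prod_card_fiber_le_inducedCopies H fun i => (e i).1
    simp only [hcard] at h
    exact_mod_cast h
end

section
/- Let l ≥ 2 be an integer. Then every finite simple graph G with exactly m edges contains at most m^l / (2·(l−1)^{l−1}) induced copies of the path P_{2l} on 2l vertices. -/
open SimpleGraph

/-- Weighted AM-GM in integer form: `s * (b / k) ^ k` is at most `((s + b) / (k + 1)) ^ (k + 1)`. -/
theorem mul_pow_mul_succ_pow_le (s b k : ℕ) :
    s * b ^ k * (k + 1) ^ (k + 1) ≤ k ^ k * (s + b) ^ (k + 1) := by
  rcases Nat.eq_zero_or_pos k with rfl | hk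
  · simp
  rcases Nat.eq_zero_or_pos b with rfl | hb
  · simp [hk.ne']
  have hk' : (0 : ℝ) < k := by exact_mod_cast hk
  have hb' : (0 : ℝ) < b := by exact_mod_cast hb
  set y : ℝ := k * (s + b) / ((k + 1) * b) with hy
  have hy0 : 0 ≤ y := by positivity
  have bernoulli := one_add_mul_le_pow (a := y - 1) (by linarith) (k + 1)
  have hleft : 1 + ((k + 1 : ℕ) : ℝ) * (y - 1) = s * k / b := by
    rw [hy]; push_cast; field_simp; ring
  rw [hleft, add_sub_cancel, hy, div_pow, div_le_div_iff₀ hb' (by positivity), mul_pow,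
    mul_pow] at bernoulli
  have key : (s : ℝ) * b ^ k * (k + 1) ^ (k + 1) * (k * b) ≤
      k ^ k * (s + b) ^ (k + 1) * (k * b) := by
    calc _ = (s : ℝ) * k * ((k + 1) ^ (k + 1) * b ^ (k + 1)) := by ring
      _ ≤ _ := bernoulli
      _ = _ := by ring
  exact_mod_cast le_of_mul_le_mul_right key (by positivity)

/-- A sequence in which a term is related to a later one exactly when the two are consecutive. -/
def IsInducedSeq {α : Type*} (r : α → α → Prop) {n : ℕ} (f : Fin n → α) : Prop :=
  ∀ i j : Fin n, i < j → (r (f i) (f j) ↔ (j : ℕ) = i + 1)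

theorem IsInducedSeq.tail {α : Type*} {r : α → α → Prop} {n : ℕ} {f : Fin (n + 1) → α}
    (hf : IsInducedSeq r f) : IsInducedSeq r (Fin.tail f) := by
  intro i j hij
  have := hf i.succ j.succ (Fin.succ_lt_succ_iff.2 hij)
  simpa [Fin.tail] using this

open Classical in
theorem card_inducedSeq_from_le {α : Type*} [Fintype α] (r : α → α → Prop) (k : ℕ)
    (R : Finset α) (a : α) :
    (Finset.univ.filter fun f : Fin (k + 1) → α =>
      f 0 = a ∧ (∀ i : Fin k, f i.succ ∈ R) ∧ IsInducedSeq r f).card * k ^ k ≤ R.card ^ k := by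
  induction k generalizing R a with
  | zero =>
    simp only [pow_zero, mul_one]
    refine Finset.card_le_one.2 fun f hf g hg => funext fun i => ?_
    simp only [Finset.mem_filter] at hf hg
    rw [Fin.fin_one_eq_zero i, hf.2.1, hg.2.1]
  | succ k ih =>
    set T := Finset.univ.filter fun f : Fin (k + 1 + 1) → α =>
      f 0 = a ∧ (∀ i : Fin (k + 1), f i.succ ∈ R) ∧ IsInducedSeq r f with hT
    set A := R.filter fun x => r a x with hA
    set B := R.filter fun x => ¬ r a x with hB
    have hmaps : ∀ f ∈ T, f 1 ∈ A := by
      intro f hf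
      obtain ⟨-, h0, hR, hf⟩ := Finset.mem_filter.1 hf
      refine Finset.mem_filter.2 ⟨hR 0, ?_⟩
      rw [← h0]
      exact (hf 0 1 (by simp)).2 (by simp)
    have hfiber : ∀ x ∈ A, (T.filter fun f => f 1 = x).card * k ^ k ≤ B.card ^ k := by
      intro x _
      refine le_trans (Nat.mul_le_mul_right _ ?_) (ih B x)
      refine Finset.card_le_card_of_injOn Fin.tail ?_ ?_
      · intro f hf
        obtain ⟨hf, hx⟩ := Finset.mem_filter.1 hf
        obtain ⟨-, h0, hR, hf⟩ := Finset.mem_filter.1 hf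
        refine Finset.mem_filter.2 ⟨Finset.mem_univ _, hx, fun i => ?_, hf.tail⟩
        refine Finset.mem_filter.2 ⟨hR i.succ, ?_⟩
        rw [← h0, Fin.tail, hf 0 _ (Fin.succ_pos _)]
        simp
      · intro f hf g hg hfg
        have hf0 := (Finset.mem_filter.1 (Finset.mem_filter.1 hf).1).2.1
        have hg0 := (Finset.mem_filter.1 (Finset.mem_filter.1 hg).1).2.1
        rw [← Fin.cons_self_tail f, ← Fin.cons_self_tail g, hfg, hf0, hg0]
    have hcard : T.card * k ^ k ≤ A.card * B.card ^ k := by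
      rw [Finset.card_eq_sum_card_fiberwise hmaps, Finset.sum_mul, ← smul_eq_mul]
      exact Finset.sum_le_card_nsmul _ _ _ hfiber
    have hAB : A.card + B.card = R.card := Finset.card_filter_add_card_filter_not _
    refine Nat.le_of_mul_le_mul_left ?_ (Nat.pow_self_pos (n := k))
    calc k ^ k * (T.card * (k + 1) ^ (k + 1)) = T.card * k ^ k * (k + 1) ^ (k + 1) := by ring
      _ ≤ A.card * B.card ^ k * (k + 1) ^ (k + 1) := Nat.mul_le_mul_right _ hcard
      _ ≤ k ^ k * (A.card + B.card) ^ (k + 1) := mul_pow_mul_succ_pow_le _ _ _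
      _ = k ^ k * R.card ^ (k + 1) := by rw [hAB]

open Classical in
theorem card_inducedSeq_le {α : Type*} [Fintype α] (r : α → α → Prop) (k : ℕ) (R : Finset α) :
    (Finset.univ.filter fun f : Fin (k + 1) → α =>
      (∀ i, f i ∈ R) ∧ IsInducedSeq r f).card * k ^ k ≤ R.card ^ (k + 1) := by
  set T := Finset.univ.filter fun f : Fin (k + 1) → α => (∀ i, f i ∈ R) ∧ IsInducedSeq r f
  have hmaps : ∀ f ∈ T, f 0 ∈ R := fun f hf => (Finset.mem_filter.1 hf).2.1 0
  rw [Finset.card_eq_sum_card_fiberwise hmaps, Finset.sum_mul, pow_succ', ← smul_eq_mul]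
  refine Finset.sum_le_card_nsmul _ _ _ fun a _ => ?_
  refine le_trans (Nat.mul_le_mul_right _ (Finset.card_le_card fun f hf => ?_))
    (card_inducedSeq_from_le r k R a)
  obtain ⟨hf, ha⟩ := Finset.mem_filter.1 hf
  obtain ⟨-, hR, hf⟩ := Finset.mem_filter.1 hf
  exact Finset.mem_filter.2 ⟨Finset.mem_univ _, ha, fun i => hR i.succ, hf⟩

/-- Every other edge of a path on `2 * l` vertices, starting with the first one. -/
def alternateEdges {V : Type*} {l : ℕ} (p : Fin (2 * l) → V) (i : Fin l) : Sym2 V :=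
  s(p ⟨2 * i, by omega⟩, p ⟨2 * i + 1, by omega⟩)

theorem exists_mem_alternateEdges_iff {V : Type*} {l : ℕ} (p : Fin (2 * l) → V) (v : V) :
    (∃ i, v ∈ alternateEdges p i) ↔ v ∈ Set.range p := by
  constructor
  · rintro ⟨i, hi⟩
    rcases Sym2.mem_iff.1 hi with rfl | rfl <;> exact Set.mem_range_self _
  · rintro ⟨j, rfl⟩
    refine ⟨⟨j / 2, by omega⟩, Sym2.mem_iff.2 ?_⟩
    rcases Nat.mod_two_eq_zero_or_one j with h | h
    · left; congr 1; ext; simp only; omega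
    · right; congr 1; ext; simp only; omega

theorem alternateEdges_mem_edgeSet {V : Type*} {G : SimpleGraph V} {l : ℕ}
    (p : pathGraph (2 * l) ↪g G) (i : Fin l) : alternateEdges p i ∈ G.edgeSet := by
  rw [alternateEdges, mem_edgeSet, p.map_adj_iff, pathGraph_adj]
  simp

theorem isInducedSeq_alternateEdges {V : Type*} {G : SimpleGraph V} {l : ℕ}
    (p : pathGraph (2 * l) ↪g G) :
    IsInducedSeq (fun e e' => ∃ u ∈ e, ∃ v ∈ e', G.Adj u v) (alternateEdges p) := by
  intro i j hij
  have hij' : (i : ℕ) < j := hij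
  simp only [alternateEdges, Sym2.mem_iff, exists_eq_or_imp, exists_eq_left, p.map_adj_iff,
    pathGraph_adj]
  omega

theorem alternateEdges_rev_ne {V : Type*} {l : ℕ} (hl : 2 ≤ l) {p : Fin (2 * l) → V}
    (hp : Function.Injective p) : alternateEdges (p ∘ Fin.rev) ≠ alternateEdges p := by
  intro h
  have h0 := congrFun h ⟨0, by omega⟩
  simp only [alternateEdges, Function.comp_apply, Sym2.eq_iff, hp.eq_iff, Fin.ext_iff,
    Fin.val_rev] at h0
  omega

/-- The reversal of a path as an automorphism. -/
def pathGraphRev (n : ℕ) : pathGraph n ≃g pathGraph n where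
  toEquiv := Fin.revPerm
  map_rel_iff' := by
    intro a b
    simp only [pathGraph_adj, Fin.revPerm_apply, Fin.val_rev]
    omega

open Classical in
theorem two_mul_inducedCopies_pathGraph_le {V : Type*} [Fintype V] (G : SimpleGraph V) {l : ℕ}
    (hl : 2 ≤ l) :
    2 * inducedCopies G (pathGraph (2 * l)) ≤
      (Finset.univ.filter fun f : Fin l → Sym2 V => (∀ i, f i ∈ G.edgeFinset) ∧
        IsInducedSeq (fun e e' => ∃ u ∈ e, ∃ v ∈ e', G.Adj u v) f).card := by
  set C := Finset.univ.filter fun S : Finset V =>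
    Nonempty ((G.induce (S : Set V)) ≃g pathGraph (2 * l)) with hC
  have hcopies : inducedCopies G (pathGraph (2 * l)) = C.card := by
    rw [inducedCopies, ← Set.ncard_coe_finset, hC]
    simp
  have hpath : ∀ S : C, ∃ p : pathGraph (2 * l) ↪g G, Set.range p = (S : Finset V) := by
    rintro ⟨S, hS⟩
    obtain ⟨φ⟩ := (Finset.mem_filter.1 hS).2
    refine ⟨(Embedding.induce (S : Set V)).comp φ.symm.toEmbedding, ?_⟩
    ext v
    constructor
    · rintro ⟨i, rfl⟩
      exact (φ.symm i).2
    · intro hv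
      exact ⟨φ ⟨v, hv⟩, by simp⟩
  choose p hp using hpath
  let q : C × Bool → (pathGraph (2 * l) ↪g G) := fun x =>
    if x.2 then (p x.1).comp (pathGraphRev (2 * l)).toEmbedding else p x.1
  have hq : ∀ x, Set.range (q x) = ((x.1 : Finset V) : Set V) := by
    rintro ⟨S, b⟩
    rw [← hp S]
    cases b
    · simp [q]
    · exact (pathGraphRev (2 * l)).surjective.range_comp (p S)
  have hinj : Function.Injective fun x => alternateEdges (q x) := by
    rintro ⟨S, b⟩ ⟨S', b'⟩ h
    have hS : S = S' := by
      refine Subtype.ext (Finset.coe_injective ?_)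
      rw [← hq (S, b), ← hq (S', b')]
      ext v
      rw [← exists_mem_alternateEdges_iff, ← exists_mem_alternateEdges_iff]
      simp only [] at h
      rw [h]
    subst hS
    have hne := alternateEdges_rev_ne hl (p S).injective
    cases b <;> cases b'
    · rfl
    · exact absurd h.symm hne
    · exact absurd h hne
    · rfl
  calc 2 * inducedCopies G (pathGraph (2 * l)) = (Finset.univ : Finset (C × Bool)).card := by
        simp [hcopies, mul_comm]
    _ ≤ _ := Finset.card_le_card_of_injOn (fun x => alternateEdges (q x))
        (fun x _ => Finset.mem_filter.2 ⟨Finset.mem_univ _,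
          fun i => mem_edgeFinset.2 (alternateEdges_mem_edgeSet _ i),
          isInducedSeq_alternateEdges _⟩) hinj.injOn

theorem even_path_upper_bound (l : ℕ) (hl : 2 ≤ l) {V : Type*} [Fintype V]
    (G : SimpleGraph V) (m : ℕ) (hG : G.edgeSet.ncard = m) :
    (inducedCopies G (SimpleGraph.pathGraph (2 * l)) : ℝ) ≤
      (m : ℝ) ^ l / (2 * ((l : ℝ) - 1) ^ (l - 1)) := by
  classical
  have hm : G.edgeFinset.card = m := by
    rw [← hG, ← coe_edgeFinset, Set.ncard_coe_finset]
  obtain ⟨k, rfl⟩ : ∃ k, l = k + 1 := ⟨l - 1, by omega⟩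
  have hk : (0 : ℝ) < k := by exact_mod_cast (by omega : 0 < k)
  have hcopies := two_mul_inducedCopies_pathGraph_le G hl
  have hseq := card_inducedSeq_le (fun e e' => ∃ u ∈ e, ∃ v ∈ e', G.Adj u v) k G.edgeFinset
  rw [hm] at hseq
  have hcount : 2 * inducedCopies G (pathGraph (2 * (k + 1))) * k ^ k ≤ m ^ (k + 1) := by
    refine (Nat.mul_le_mul_right _ (hcopies.trans_eq ?_)).trans hseq
    congr!
  have hcast : (inducedCopies G (pathGraph (2 * (k + 1))) : ℝ) * (2 * (k : ℝ) ^ k) ≤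
      (m : ℝ) ^ (k + 1) := by
    calc _ = (2 : ℝ) * inducedCopies G (pathGraph (2 * (k + 1))) * (k : ℝ) ^ k := by ring
      _ ≤ _ := by exact_mod_cast hcount
  rw [le_div_iff₀ (by simp; positivity)]
  simpa using hcast
end

section
/- Let l ≥ 2 be an integer and ε ∈ (0,1). Then there exists M such that for every integer m ≥ M there exists a finite simple graph G with at most m edges containing at least (1−ε) · (2l+1) · (m/(2l+1))^l induced copies of the path P_{2l} on 2l vertices. -/
open SimpleGraph

/-- The blow-up of the cycle `C_{d+2}` with parts of size `n`, on the vertex set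
`Fin ((d + 2) * n)`. -/
def cycleBlowup (d n : ℕ) : SimpleGraph (Fin ((d + 2) * n)) :=
  (cycleGraph (d + 2)).comap fun x => (finProdFinEquiv.symm x).1

lemma cycleBlowup_adj {d n : ℕ} (i j : Fin (d + 2)) (a b : Fin n) :
    (cycleBlowup d n).Adj (finProdFinEquiv (i, a)) (finProdFinEquiv (j, b)) ↔
      i - j = 1 ∨ j - i = 1 := by
  rw [cycleBlowup, comap_adj, Equiv.symm_apply_apply, Equiv.symm_apply_apply, cycleGraph_adj]

lemma ncard_edgeSet_cycleBlowup_le (d n : ℕ) :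
    (cycleBlowup d n).edgeSet.ncard ≤ (d + 2) * n ^ 2 := by
  let F : Fin (d + 2) × Fin n × Fin n → Sym2 (Fin ((d + 2) * n)) := fun p =>
    s(finProdFinEquiv (p.1, p.2.1), finProdFinEquiv (p.1 + 1, p.2.2))
  have hsub : (cycleBlowup d n).edgeSet ⊆ F '' Set.univ := by
    intro e
    induction e using Sym2.ind with
    | _ x y =>
      obtain ⟨⟨i, a⟩, rfl⟩ := finProdFinEquiv.surjective x
      obtain ⟨⟨j, b⟩, rfl⟩ := finProdFinEquiv.surjective y
      rw [mem_edgeSet, cycleBlowup_adj]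
      rintro (h | h)
      · refine ⟨(j, b, a), Set.mem_univ _, ?_⟩
        obtain rfl : i = j + 1 := by rw [← h]; abel
        exact Sym2.eq_swap
      · refine ⟨(i, a, b), Set.mem_univ _, ?_⟩
        obtain rfl : j = i + 1 := by rw [← h]; abel
        rfl
  calc _ ≤ (F '' Set.univ).ncard := Set.ncard_le_ncard hsub (Set.toFinite _)
    _ ≤ (Set.univ : Set (Fin (d + 2) × Fin n × Fin n)).ncard := Set.ncard_image_le
    _ = (d + 2) * n ^ 2 := by
      rw [Set.ncard_univ]
      simp [pow_two]

lemma nonempty_induce_map_iso {V W : Type*} [Fintype W] {G : SimpleGraph V} {H : SimpleGraph W}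
    (φ : H ↪g G) :
    Nonempty (G.induce ((Finset.univ.map φ.toEmbedding : Finset V) : Set V) ≃g H) := by
  let ψ : W → ((Finset.univ.map φ.toEmbedding : Finset V) : Set V) := fun w => ⟨φ w, by simp⟩
  have hψ : Function.Bijective ψ := by
    refine ⟨fun a b h => φ.injective (congrArg Subtype.val h), ?_⟩
    rintro ⟨x, hx⟩
    obtain ⟨w, -, rfl⟩ := Finset.mem_map.1 hx
    exact ⟨w, rfl⟩
  exact ⟨RelIso.symm ⟨Equiv.ofBijective ψ hψ, fun {a b} => φ.map_rel_iff⟩⟩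

lemma Fin.succ_sub_succ_eq_one_iff {d : ℕ} (i j : Fin (d + 1)) :
    i.succ - j.succ = 1 ↔ j.val + 1 = i.val := by
  rw [sub_eq_iff_eq_add, Fin.ext_iff, Fin.val_add, Fin.val_one, Fin.val_succ, Fin.val_succ]
  have hi := i.isLt
  have hj := j.isLt
  rcases Nat.lt_or_ge (1 + (j.val + 1)) (d + 2) with h | h
  · rw [Nat.mod_eq_of_lt h]
    omega
  · rw [show 1 + (j.val + 1) = d + 2 by omega, Nat.mod_self]
    omega

/-- The induced path in the blow-up that avoids the part `c` and takes the vertices `f` in the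
other parts, in cyclic order. -/
def pathEmbeddingCycleBlowup {d n : ℕ} (c : Fin (d + 2)) (f : Fin (d + 1) → Fin n) :
    pathGraph (d + 1) ↪g cycleBlowup d n where
  toFun j := finProdFinEquiv (c + j.succ, f j)
  inj' i j h := by
    simpa using congrArg Prod.fst (finProdFinEquiv.injective h)
  map_rel_iff' {i j} := by
    change (cycleBlowup d n).Adj (finProdFinEquiv (c + i.succ, f i))
      (finProdFinEquiv (c + j.succ, f j)) ↔ _
    rw [cycleBlowup_adj, add_sub_add_left_eq_sub, add_sub_add_left_eq_sub,
      Fin.succ_sub_succ_eq_one_iff, Fin.succ_sub_succ_eq_one_iff, pathGraph_adj, or_comm]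

lemma mem_map_pathEmbeddingCycleBlowup {d n : ℕ} {c : Fin (d + 2)} {f : Fin (d + 1) → Fin n}
    {i : Fin (d + 2)} {a : Fin n} :
    finProdFinEquiv (i, a) ∈ Finset.univ.map (pathEmbeddingCycleBlowup c f).toEmbedding ↔
      ∃ j, c + j.succ = i ∧ f j = a := by
  rw [Finset.mem_map]
  constructor
  · rintro ⟨j, -, hj⟩
    exact ⟨j, Prod.ext_iff.1 (finProdFinEquiv.injective hj)⟩
  · rintro ⟨j, rfl, rfl⟩
    exact ⟨j, Finset.mem_univ _, rfl⟩

lemma map_pathEmbeddingCycleBlowup_injective (d n : ℕ) :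
    Function.Injective fun p : Fin (d + 2) × (Fin (d + 1) → Fin n) =>
      Finset.univ.map (pathEmbeddingCycleBlowup p.1 p.2).toEmbedding := by
  rintro ⟨c, f⟩ ⟨c', f'⟩ h
  have key : ∀ j, ∃ j', c' + j'.succ = c + j.succ ∧ f' j' = f j := fun j =>
    mem_map_pathEmbeddingCycleBlowup.1 <| (Finset.ext_iff.1 h _).1 <|
      mem_map_pathEmbeddingCycleBlowup.2 ⟨j, rfl, rfl⟩
  obtain rfl : c = c' := by
    by_contra hne
    obtain ⟨j, hj⟩ := Fin.exists_succ_eq.2 (sub_ne_zero.2 (Ne.symm hne))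
    obtain ⟨j', hj', -⟩ := key j
    rw [hj, add_sub_cancel, add_eq_left] at hj'
    exact Fin.succ_ne_zero _ hj'
  congr
  funext j
  obtain ⟨j', hj', hf⟩ := key j
  obtain rfl : j' = j := Fin.succ_injective _ (add_left_cancel hj')
  exact hf.symm

lemma le_inducedCopies_cycleBlowup (d n : ℕ) :
    (d + 2) * n ^ (d + 1) ≤ inducedCopies (cycleBlowup d n) (pathGraph (d + 1)) := by
  have hcard := Set.ncard_range_of_injective (map_pathEmbeddingCycleBlowup_injective d n)
  simp only [Nat.card_eq_fintype_card, Fintype.card_prod, Fintype.card_fun, Fintype.card_fin]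
    at hcard
  rw [← hcard]
  refine Set.ncard_le_ncard ?_ (Set.toFinite _)
  rintro _ ⟨p, rfl⟩
  exact nonempty_induce_map_iso _

lemma one_sub_mul_succ_pow_le {ε : ℝ} (n k : ℕ) (h : (k : ℝ) ≤ ε * (n + 1)) :
    (1 - ε) * ((n : ℝ) + 1) ^ k ≤ (n : ℝ) ^ k := by
  have hn : (0 : ℝ) < n + 1 := by positivity
  have hb := one_add_mul_le_pow (a := -(1 / ((n : ℝ) + 1))) (by
    have : 1 / ((n : ℝ) + 1) ≤ 1 := by
      rw [div_le_one hn]; linarith [n.cast_nonneg (α := ℝ)]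
    linarith) k
  have h1 : 1 - ε ≤ 1 + (k : ℝ) * -(1 / ((n : ℝ) + 1)) := by
    have : (k : ℝ) / (n + 1) ≤ ε := (div_le_iff₀ hn).2 h
    have e : (k : ℝ) * -(1 / ((n : ℝ) + 1)) = -(k / (n + 1)) := by ring
    linarith
  calc _ ≤ (1 + -(1 / ((n : ℝ) + 1))) ^ k * ((n : ℝ) + 1) ^ k := by gcongr; exact h1.trans hb
    _ = (n : ℝ) ^ k := by
      rw [← mul_pow]
      congr 1
      field_simp
      ring

theorem even_path_lower_bound (l : ℕ) (hl : 2 ≤ l) (ε : ℝ) (hε : ε ∈ Set.Ioo (0 : ℝ) 1) :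
    ∃ M : ℕ, ∀ m : ℕ, M ≤ m → ∃ (n : ℕ) (G : SimpleGraph (Fin n)),
      G.edgeSet.ncard ≤ m ∧
      (1 - ε) * (2 * (l : ℝ) + 1) * ((m : ℝ) / (2 * (l : ℝ) + 1)) ^ l ≤
        (inducedCopies G (SimpleGraph.pathGraph (2 * l)) : ℝ) := by
  obtain ⟨hε0, hε1⟩ := hε
  obtain ⟨N, hN⟩ := exists_nat_ge ((2 * l : ℕ) / ε)
  obtain ⟨d, hd⟩ : ∃ d, 2 * l = d + 1 := ⟨2 * l - 1, by omega⟩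
  refine ⟨(d + 2) * N ^ 2, fun m hm => ?_⟩
  set n := Nat.sqrt (m / (d + 2)) with hn
  have hNn : N ≤ n := by
    rw [hn, Nat.le_sqrt', Nat.le_div_iff_mul_le (by omega), mul_comm]
    exact hm
  have hle : (d + 2) * n ^ 2 ≤ m := by
    rw [mul_comm, ← Nat.le_div_iff_mul_le (by omega)]
    exact Nat.sqrt_le' _
  have hlt : m < (d + 2) * (n + 1) ^ 2 := by
    rw [mul_comm, ← Nat.div_lt_iff_lt_mul (by omega)]
    exact Nat.lt_succ_sqrt' _
  refine ⟨_, cycleBlowup d n, (ncard_edgeSet_cycleBlowup_le d n).trans hle, ?_⟩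
  have hd' : 2 * (l : ℝ) + 1 = (d : ℝ) + 2 := by
    have : (2 * l : ℝ) = d + 1 := by exact_mod_cast hd
    linarith
  have hdpos : (0 : ℝ) < (d : ℝ) + 2 := by positivity
  have hdiv : (m : ℝ) / (d + 2) ≤ ((n : ℝ) + 1) ^ 2 := by
    rw [div_le_iff₀' hdpos]
    exact_mod_cast hlt.le
  have hbern := one_sub_mul_succ_pow_le (ε := ε) n (2 * l) <| by
    rw [div_le_iff₀' hε0] at hN
    have : (N : ℝ) ≤ n + 1 := by exact_mod_cast hNn.trans n.le_succ
    exact hN.trans (by gcongr)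
  have hcount : ((d : ℝ) + 2) * (n : ℝ) ^ (2 * l) ≤
      inducedCopies (cycleBlowup d n) (pathGraph (2 * l)) := by
    rw [hd]
    exact_mod_cast le_inducedCopies_cycleBlowup d n
  rw [hd']
  have h1ε : 0 ≤ 1 - ε := by linarith
  calc _ ≤ (1 - ε) * ((d : ℝ) + 2) * (((n : ℝ) + 1) ^ 2) ^ l := by gcongr
    _ = ((d : ℝ) + 2) * ((1 - ε) * ((n : ℝ) + 1) ^ (2 * l)) := by rw [← pow_mul]; ring
    _ ≤ ((d : ℝ) + 2) * (n : ℝ) ^ (2 * l) := by gcongr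
    _ ≤ _ := hcount
end

section
/- Let l ≥ 2 be an integer and ε ∈ (0,1). Then there exists M such that for every integer m ≥ M there exists a finite simple graph G with at most m edges containing at least (1−ε) · 4 · (m/(2l+2))^{l+1} induced copies of the path P_{2l+1} on 2l+1 vertices. -/
open SimpleGraph

/-- The blow-up of `H` in which the vertex `i` is replaced by an independent set of size `s i`,
transported along an equivalence of its vertex type with `V`. -/
def sigmaBlowUp {W V : Type*} (H : SimpleGraph W) (s : W → ℕ) (e : (Σ i, Fin (s i)) ≃ V) :
    SimpleGraph V :=
  H.comap fun v => (e.symm v).1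

theorem prod_le_inducedCopies_sigmaBlowUp {W V : Type*} [Fintype W] [Fintype V]
    (H : SimpleGraph W) (s : W → ℕ) (e : (Σ i, Fin (s i)) ≃ V) :
    ∏ i, s i ≤ inducedCopies (sigmaBlowUp H s e) H := by
  classical
  let φ : ((i : W) → Fin (s i)) → Finset V := fun g => Finset.univ.image fun i => e ⟨i, g i⟩
  have hφ : Function.Injective φ := by
    intro g h hgh
    funext i
    have hi : e ⟨i, g i⟩ ∈ φ h := by
      rw [← hgh]
      exact Finset.mem_image_of_mem _ (Finset.mem_univ i)
    obtain ⟨j, -, hj⟩ := Finset.mem_image.1 hi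
    have hs := e.injective hj
    obtain rfl : j = i := congrArg Sigma.fst hs
    exact (eq_of_heq (Sigma.mk.inj hs).2).symm
  have hcard : (Set.range φ).ncard = ∏ i, s i := by
    rw [← Set.image_univ, Set.ncard_image_of_injective _ hφ, Set.ncard_univ,
      Nat.card_eq_fintype_card, Fintype.card_pi]
    simp
  rw [← hcard]
  refine Set.ncard_le_ncard ?_ (Set.toFinite _)
  rintro _ ⟨g, rfl⟩
  let ψ : W → ((φ g : Finset V) : Set V) := fun i =>
    ⟨e ⟨i, g i⟩, Finset.mem_coe.2 (Finset.mem_image_of_mem _ (Finset.mem_univ i))⟩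
  have hψ : Function.Bijective ψ := by
    constructor
    · intro i j hij
      exact congrArg Sigma.fst (e.injective (congrArg Subtype.val hij))
    · rintro ⟨v, hv⟩
      obtain ⟨i, -, hi⟩ := Finset.mem_image.1 (Finset.mem_coe.1 hv)
      exact ⟨i, Subtype.ext hi⟩
  refine ⟨SimpleGraph.Iso.symm ⟨Equiv.ofBijective ψ hψ, ?_⟩⟩
  intro i j
  simp [sigmaBlowUp, ψ]

theorem ncard_edgeSet_sigmaBlowUp_pathGraph_le {V : Type*} [Fintype V] (N : ℕ) (s : ℕ → ℕ)
    (e : (Σ i : Fin (N + 1), Fin (s i)) ≃ V) :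
    (sigmaBlowUp (pathGraph (N + 1)) (fun i : Fin (N + 1) => s i) e).edgeSet.ncard ≤
      ∑ i ∈ Finset.range N, s i * s (i + 1) := by
  classical
  let ψ : (Σ i : Fin N, Fin (s i) × Fin (s (i + 1))) → Sym2 V := fun x =>
    s(e ⟨x.1.castSucc, x.2.1⟩, e ⟨x.1.succ, x.2.2⟩)
  have hsub : (sigmaBlowUp (pathGraph (N + 1)) (fun i : Fin (N + 1) => s i) e).edgeSet ⊆ Set.range ψ := by
    have key : ∀ u v : Σ i : Fin (N + 1), Fin (s i), u.1.val + 1 = v.1.val →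
        s(e u, e v) ∈ Set.range ψ := by
      rintro ⟨⟨i, hi⟩, a⟩ ⟨⟨j, hj⟩, b⟩ h
      dsimp only at h
      subst h
      exact ⟨⟨⟨i, by omega⟩, a, b⟩, rfl⟩
    intro x
    induction x using Sym2.ind with
    | _ u v =>
      intro h
      have h' := pathGraph_adj.1 (show (pathGraph (N + 1)).Adj (e.symm u).1 (e.symm v).1 from h)
      rcases h' with h' | h'
      · simpa using key _ _ h'
      · simpa [Sym2.eq_swap] using key _ _ h'
  calc _ ≤ (Set.range ψ).ncard := Set.ncard_le_ncard hsub (Set.toFinite _)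
    _ ≤ Nat.card (Σ i : Fin N, Fin (s i) × Fin (s (i + 1))) := by
      rw [← Set.image_univ, ← Set.ncard_univ]
      exact Set.ncard_image_le
    _ = _ := by
      rw [Nat.card_eq_fintype_card, Fintype.card_sigma, Finset.sum_range]
      simp

/-- Part sizes of the blow-up of the path on `2 * l + 1` vertices: odd positions are single
vertices, the two ends have size `2 * b` and the other even positions have size `b`. -/
def oddPathPartSize (l b i : ℕ) : ℕ :=
  if i % 2 = 1 then 1 else if i = 0 ∨ i = 2 * l then 2 * b else b

theorem oddPathPartSize_odd (l b k : ℕ) : oddPathPartSize l b (2 * k + 1) = 1 := by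
  rw [oddPathPartSize, if_pos (by omega)]

theorem oddPathPartSize_zero (l b : ℕ) : oddPathPartSize l b 0 = 2 * b := by
  simp [oddPathPartSize]

theorem oddPathPartSize_last (l b : ℕ) : oddPathPartSize l b (2 * l) = 2 * b := by
  simp [oddPathPartSize]

theorem oddPathPartSize_inner {l k : ℕ} (b : ℕ) (hk : k + 1 < l) :
    oddPathPartSize l b (2 * k + 2) = b := by
  rw [oddPathPartSize, if_neg (by omega), if_neg (by omega)]

theorem sum_oddPathPartSize {l : ℕ} (b : ℕ) (hl : 1 ≤ l) :
    ∑ i ∈ Finset.range (2 * l), oddPathPartSize l b i * oddPathPartSize l b (i + 1) =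
      (2 * l + 2) * b := by
  have h : ∀ k < l, ∑ i ∈ Finset.range (2 * k + 1),
      oddPathPartSize l b i * oddPathPartSize l b (i + 1) = 2 * b + 2 * b * k := by
    intro k
    induction k with
    | zero =>
      intro _
      have := oddPathPartSize_odd l b 0
      simp_all [oddPathPartSize_zero]
    | succ k ih =>
      intro hk
      rw [show 2 * (k + 1) + 1 = 2 * k + 1 + 1 + 1 by ring, Finset.sum_range_succ,
        Finset.sum_range_succ, ih (by omega), show 2 * k + 1 + 1 + 1 = 2 * (k + 1) + 1 by ring,
        oddPathPartSize_odd, oddPathPartSize_odd, show 2 * k + 1 + 1 = 2 * k + 2 by ring,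
        oddPathPartSize_inner b hk]
      ring
  obtain ⟨k, rfl⟩ := Nat.exists_eq_add_of_le' hl
  have hlast := oddPathPartSize_last (k + 1) b
  rw [show 2 * (k + 1) = 2 * k + 1 + 1 by ring] at hlast ⊢
  rw [Finset.sum_range_succ, h k (by omega), oddPathPartSize_odd, hlast]
  ring

theorem prod_oddPathPartSize {l : ℕ} (b : ℕ) (hl : 1 ≤ l) :
    ∏ i ∈ Finset.range (2 * l + 1), oddPathPartSize l b i = 4 * b ^ (l + 1) := by
  have h : ∀ k < l, ∏ i ∈ Finset.range (2 * k + 1), oddPathPartSize l b i = 2 * b * b ^ k := by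
    intro k
    induction k with
    | zero => simp [oddPathPartSize_zero]
    | succ k ih =>
      intro hk
      rw [show 2 * (k + 1) + 1 = 2 * k + 1 + 1 + 1 by ring, Finset.prod_range_succ,
        Finset.prod_range_succ, ih (by omega), oddPathPartSize_odd,
        show 2 * k + 1 + 1 = 2 * k + 2 by ring, oddPathPartSize_inner b hk]
      ring
  obtain ⟨k, rfl⟩ := Nat.exists_eq_add_of_le' hl
  rw [Finset.prod_range_succ, oddPathPartSize_last, show 2 * (k + 1) = 2 * k + 1 + 1 by ring,
    Finset.prod_range_succ, h k (by omega), oddPathPartSize_odd]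
  ring

theorem one_sub_mul_pow_le_floor_pow {x ε : ℝ} (k : ℕ) (hx : 1 ≤ x)
    (hkx : k ≤ ε * x) : (1 - ε) * x ^ k ≤ (⌊x⌋₊ : ℝ) ^ k := by
  have hx0 : 0 < x := by linarith
  have hinv : x⁻¹ ≤ 1 := inv_le_one_of_one_le₀ hx
  have hbern : 1 - ε ≤ (1 - x⁻¹) ^ k := by
    have h := one_add_mul_le_pow (a := -x⁻¹) (by linarith) k
    have : (k : ℝ) * x⁻¹ ≤ ε := by
      rw [← div_eq_mul_inv, div_le_iff₀ hx0]
      exact hkx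
    rw [← sub_eq_add_neg] at h
    linarith
  calc (1 - ε) * x ^ k ≤ (1 - x⁻¹) ^ k * x ^ k := by gcongr
    _ = (x - 1) ^ k := by
      rw [← mul_pow, sub_mul, inv_mul_cancel₀ hx0.ne', one_mul]
    _ ≤ (⌊x⌋₊ : ℝ) ^ k :=
      pow_le_pow_left₀ (by linarith) (Nat.sub_one_lt_floor x).le k

theorem odd_path_lower_bound (l : ℕ) (hl : 2 ≤ l) (ε : ℝ) (hε : ε ∈ Set.Ioo (0 : ℝ) 1) :
    ∃ M : ℕ, ∀ m : ℕ, M ≤ m → ∃ (n : ℕ) (G : SimpleGraph (Fin n)),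
      G.edgeSet.ncard ≤ m ∧
      (1 - ε) * 4 * ((m : ℝ) / (2 * (l : ℝ) + 2)) ^ (l + 1) ≤
        (inducedCopies G (SimpleGraph.pathGraph (2 * l + 1)) : ℝ) := by
  obtain ⟨hε0, hε1⟩ := hε
  obtain ⟨M, hM⟩ := exists_nat_ge ((2 * (l : ℝ) + 2) * ((l + 1 : ℕ) / ε))
  refine ⟨M, fun m hm => ?_⟩
  have hd : (0 : ℝ) < 2 * (l : ℝ) + 2 := by positivity
  set x : ℝ := (m : ℝ) / (2 * (l : ℝ) + 2) with hxdef
  have hx : ((l + 1 : ℕ) : ℝ) / ε ≤ x := by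
    rw [hxdef, le_div_iff₀ hd, mul_comm]
    exact hM.trans (by exact_mod_cast hm)
  have hkx : ((l + 1 : ℕ) : ℝ) ≤ ε * x := by
    rw [mul_comm]
    exact (div_le_iff₀ hε0).1 hx
  have hx1 : 1 ≤ x := by
    refine le_trans ?_ hx
    rw [le_div_iff₀ hε0]
    push_cast
    have : (0 : ℝ) ≤ l := by positivity
    linarith
  set b := ⌊x⌋₊
  let s : ℕ → ℕ := oddPathPartSize l b
  let e := Fintype.equivFin (Σ i : Fin (2 * l + 1), Fin (s i))
  refine ⟨_, sigmaBlowUp (pathGraph (2 * l + 1)) (fun i : Fin (2 * l + 1) => s i) e, ?_, ?_⟩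
  · refine (ncard_edgeSet_sigmaBlowUp_pathGraph_le (2 * l) s e).trans ?_
    rw [sum_oddPathPartSize b (by omega)]
    have hbx : (b : ℝ) ≤ x := Nat.floor_le (by linarith)
    rw [hxdef, le_div_iff₀ hd] at hbx
    have : (((2 * l + 2) * b : ℕ) : ℝ) ≤ m := by
      push_cast
      linarith
    exact_mod_cast this
  · have hcopies := prod_le_inducedCopies_sigmaBlowUp (pathGraph (2 * l + 1)) (fun i : Fin (2 * l + 1) => s i) e
    rw [← Finset.prod_range s, prod_oddPathPartSize b (by omega)] at hcopies
    have hpow := one_sub_mul_pow_le_floor_pow (l + 1) hx1 hkx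
    calc (1 - ε) * 4 * x ^ (l + 1) = 4 * ((1 - ε) * x ^ (l + 1)) := by ring
      _ ≤ 4 * (b : ℝ) ^ (l + 1) := by gcongr
      _ ≤ _ := by exact_mod_cast hcopies
end

section
/- Every finite simple graph G with exactly m edges contains at most m²/4 induced copies of the cycle C_4 on 4 vertices. -/
open SimpleGraph

/-- Four times the number of induced four-cycles is at most the number of ordered pairs of edges:
a four-cycle is determined by a pair of opposite edges, and it has four such ordered pairs. -/
theorem four_mul_inducedCopies_cycleGraph_four_le {V : Type*} [Fintype V] (G : SimpleGraph V) :
    inducedCopies G (cycleGraph 4) * 4 ≤ G.edgeSet.ncard * G.edgeSet.ncard := by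
  let F : Set (Finset V) := {S | Nonempty (G.induce (S : Set V) ≃g cycleGraph 4)}
  let φ (S : F) : G.induce (S.1 : Set V) ≃g cycleGraph 4 := S.2.some
  let a (S : F) (i : Fin 4) : V := ((φ S).symm i).1
  have a_inj (S : F) : Function.Injective (a S) :=
    Subtype.val_injective.comp (φ S).symm.injective
  have a_adj (S : F) (i : Fin 4) : s(a S i, a S (i + 1)) ∈ G.edgeSet := by
    have h : (cycleGraph 4).Adj i (i + 1) := by
      rw [cycleGraph_adj]
      right
      simp
    exact (φ S).symm.map_rel_iff.2 h
  have mem_iff (S : F) (i : Fin 4) (v : V) : v ∈ S.1 ↔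
      v ∈ s(a S i, a S (i + 1)) ∨ v ∈ s(a S (i + 2), a S (i + 2 + 1)) := by
    constructor
    · intro hv
      obtain ⟨j, hj⟩ := (φ S).symm.surjective ⟨v, hv⟩
      have hv' : v = a S j := (congrArg Subtype.val hj).symm
      have hij : ∀ i j : Fin 4, (j = i ∨ j = i + 1) ∨ (j = i + 2 ∨ j = i + 2 + 1) := by decide
      simp only [Sym2.mem_iff, hv', (a_inj S).eq_iff]
      exact hij i j
    · simp only [Sym2.mem_iff]
      rintro ((rfl | rfl) | (rfl | rfl)) <;> exact Subtype.prop _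
  let g (p : F × Fin 4) : G.edgeSet × G.edgeSet :=
    (⟨_, a_adj p.1 p.2⟩, ⟨_, a_adj p.1 (p.2 + 2)⟩)
  have g_inj : Function.Injective g := by
    rintro ⟨S, i⟩ ⟨T, j⟩ h
    simp only [g, Prod.mk.injEq, Subtype.mk.injEq] at h
    obtain rfl : S = T := by
      ext v
      rw [mem_iff S i, mem_iff T j, h.1, h.2]
    have hij : ∀ i j : Fin 4, s(i, i + 1) = s(j, j + 1) → i = j := by decide
    rw [hij i j (Sym2.map.injective (a_inj S) h.1)]
  simpa [Nat.card_prod, F, inducedCopies, Nat.card_coe_set_eq] using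
    Nat.card_le_card_of_injective g g_inj

theorem four_cycle_upper_bound {V : Type*} [Fintype V] (G : SimpleGraph V) (m : ℕ)
    (hG : G.edgeSet.ncard = m) :
    (inducedCopies G (SimpleGraph.cycleGraph 4) : ℝ) ≤ (m : ℝ) ^ 2 / 4 := by
  have h : ((inducedCopies G (cycleGraph 4) * 4 : ℕ) : ℝ) ≤ (m * m : ℕ) := by
    exact_mod_cast hG ▸ four_mul_inducedCopies_cycleGraph_four_le G
  push_cast at h
  linarith
end

section
/- Every finite simple graph G with exactly m edges contains at most 3·(m/6)³ = m³/72 induced copies of the cycle C_6 on 6 vertices. -/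
open SimpleGraph

namespace SixCycle

/-- Cyclic relabelling of a hexagon by `k` steps. -/
def rot {α : Type*} (k : Fin 6) (v : Fin 6 → α) : Fin 6 → α := fun i => v (i + k)

/-- The dart with patterns `p`, `q` can follow the first edge of the hexagon: its first end is
adjacent to vertex `1` only among the vertices `0`, `1`, and its second end to neither. -/
def extending (p q : Fin 6 → Bool) : ℕ := (p 1 && !p 0 && !q 0 && !q 1).toNat

/-- The dart with patterns `p`, `q` closes the path `0, 1, 2, 3` of the hexagon to an induced
six-cycle. -/
def closing (p q : Fin 6 → Bool) : ℕ :=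
  (p 3 && q 0 && !p 0 && !p 1 && !p 2 && !q 1 && !q 2 && !q 3).toNat

/-- The dart with patterns `p`, `q` forms an induced path between vertices `3` and `0` of the
hexagon, with no further adjacency to it. -/
def bridging (p q : Fin 6 → Bool) : ℕ :=
  (p 3 && q 0 && !p 0 && !p 1 && !p 2 && !q 1 && !q 2 && !q 3 &&
    !p 4 && !p 5 && !q 4 && !q 5).toNat

/-- Each vertex in one of the two parity classes of the hexagon is adjacent to exactly one end of
the edge, and the vertices in the other class to none. -/
def alternating (p q : Fin 6 → Bool) : ℕ :=
  ((xor (p 0) (q 0) && xor (p 2) (q 2) && xor (p 4) (q 4) &&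
      !p 1 && !p 3 && !p 5 && !q 1 && !q 3 && !q 5) ||
    (xor (p 1) (q 1) && xor (p 3) (q 3) && xor (p 5) (q 5) &&
      !p 0 && !p 2 && !p 4 && !q 0 && !q 2 && !q 4)).toNat

/-- The edge bridges one of the two other pairs of opposite vertices, in either direction. -/
def crossing (p q : Fin 6 → Bool) : ℕ :=
  bridging (rot 1 p) (rot 1 q) + bridging (rot 4 p) (rot 4 q) +
    (bridging (rot 2 p) (rot 2 q) + bridging (rot 5 p) (rot 5 q))

/-- The edge has exactly one adjacency to each of the two neighbours of vertex `0`, or to each of the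
two neighbours of vertex `3`, and no other adjacency outside vertices `0` and `3`. -/
def sameSide (p q : Fin 6 → Bool) : Bool :=
  (xor (p 1) (q 1) && xor (p 5) (q 5) && !p 2 && !q 2 && !p 4 && !q 4) ||
    (xor (p 2) (q 2) && xor (p 4) (q 4) && !p 1 && !q 1 && !p 5 && !q 5)

/-- A weight on the edges that avoid vertices `0` and `3` and do not bridge another opposite pair.
It compensates `crossing` on average over the three hexagons of a theta graph. -/
def penalty (p q : Fin 6 → Bool) : ℕ :=
  bif !p 0 && !p 3 && !q 0 && !q 3 && Nat.beq (crossing p q) 0 then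
    bif sameSide p q then 4 else 1 else 0

set_option maxRecDepth 10000 in
theorem extending_sum_le (p q : Fin 6 → Bool) :
    ∑ k, (extending (rot k p) (rot k q) + extending (rot k q) (rot k p)) ≤
      2 + alternating p q := by
  simp only [Fin.sum_univ_six, extending, alternating, rot, Fin.reduceAdd, Fin.isValue]
  generalize p 0 = a0, p 1 = a1, p 2 = a2, p 3 = a3, p 4 = a4, p 5 = a5,
    q 0 = b0, q 1 = b1, q 2 = b2, q 3 = b3, q 4 = b4, q 5 = b5
  revert a0 a1 a2 a3 a4 a5 b0 b1 b2 b3 b4 b5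
  decide +kernel

theorem closing_sum_le (p q : Fin 6 → Bool) :
    ∑ k, (closing (rot k p) (rot k q) + closing (rot k q) (rot k p)) + alternating p q ≤
      1 + ∑ k, bridging (rot k p) (rot k q) := by
  simp only [Fin.sum_univ_six, closing, bridging, alternating, rot, Fin.reduceAdd, Fin.isValue]
  generalize p 0 = a0, p 1 = a1, p 2 = a2, p 3 = a3, p 4 = a4, p 5 = a5,
    q 0 = b0, q 1 = b1, q 2 = b2, q 3 = b3, q 4 = b4, q 5 = b5
  revert a0 a1 a2 a3 a4 a5 b0 b1 b2 b3 b4 b5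
  decide +kernel

theorem penalty_sum_le (p q : Fin 6 → Bool) :
    penalty p q + penalty (rot 1 p) (rot 1 q) + penalty (rot 2 p) (rot 2 q) +
      3 * ∑ k, (closing (rot k p) (rot k q) + closing (rot k q) (rot k p)) +
      4 * alternating p q ≤ 4 + 2 * ∑ k, bridging (rot k p) (rot k q) := by
  simp only [Fin.sum_univ_six, closing, bridging, alternating, penalty, crossing, sameSide,
    rot, Fin.reduceAdd, Fin.isValue]
  generalize p 0 = a0, p 1 = a1, p 2 = a2, p 3 = a3, p 4 = a4, p 5 = a5,
    q 0 = b0, q 1 = b1, q 2 = b2, q 3 = b3, q 4 = b4, q 5 = b5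
  revert a0 a1 a2 a3 a4 a5 b0 b1 b2 b3 b4 b5
  decide +kernel

theorem bridging_le_closing (p q : Fin 6 → Bool) : bridging p q ≤ closing p q := by
  simp only [closing, bridging]
  generalize p 0 = a0, p 1 = a1, p 2 = a2, p 3 = a3, p 4 = a4, p 5 = a5,
    q 0 = b0, q 1 = b1, q 2 = b2, q 3 = b3, q 4 = b4, q 5 = b5
  revert a0 a1 a2 a3 a4 a5 b0 b1 b2 b3 b4 b5
  decide +kernel

theorem closing_add_swap_le (p q : Fin 6 → Bool) : closing p q + closing q p ≤ 1 := by
  simp only [closing]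
  cases p 0 <;> cases p 3 <;> simp [Bool.toNat_le]

theorem bridging_swap (p q : Fin 6 → Bool) : bridging (rot 3 q) (rot 3 p) = bridging p q := by
  simp only [bridging, rot, Fin.reduceAdd, Fin.isValue]
  generalize p 0 = a0, p 1 = a1, p 2 = a2, p 3 = a3, p 4 = a4, p 5 = a5,
    q 0 = b0, q 1 = b1, q 2 = b2, q 3 = b3, q 4 = b4, q 5 = b5
  revert a0 a1 a2 a3 a4 a5 b0 b1 b2 b3 b4 b5
  decide +kernel

/-- Here `a, b` and `c, d` record the adjacencies to the inner vertices of the third path of a theta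
graph, whose three hexagons are summed over. -/
theorem crossing_theta_le (p q : Fin 6 → Bool) (a b c d : Bool) :
    2 * (crossing p q + crossing ![p 0, p 1, p 2, p 3, a, b] ![q 0, q 1, q 2, q 3, c, d] +
      crossing ![p 0, b, a, p 3, p 4, p 5] ![q 0, d, c, q 3, q 4, q 5]) ≤
    penalty p q + penalty ![p 0, p 1, p 2, p 3, a, b] ![q 0, q 1, q 2, q 3, c, d] +
      penalty ![p 0, b, a, p 3, p 4, p 5] ![q 0, d, c, q 3, q 4, q 5] := by
  simp only [crossing, penalty, bridging, sameSide, rot, Fin.reduceAdd, Fin.isValue]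
  simp only [Matrix.cons_val]
  by_cases h : p 0 = false ∧ p 3 = false ∧ q 0 = false ∧ q 3 = false
  · obtain ⟨h1, h2, h3, h4⟩ := h
    rw [h1, h2, h3, h4]
    generalize p 1 = a1, p 2 = a2, p 4 = a4, p 5 = a5, q 1 = b1, q 2 = b2, q 4 = b4, q 5 = b5
    revert a1 a2 a4 a5 b1 b2 b4 b5 a b c d
    decide +kernel
  · cases h0 : p 0 <;> cases h1 : p 3 <;> cases h2 : q 0 <;> cases h3 : q 3 <;> simp_all

theorem quad_max {a b c x y z Q : ℝ} (hb : 0 ≤ b) (hc : 0 ≤ c) (hx : 0 ≤ x) (hy : 0 ≤ y)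
    (hz : 0 ≤ z) (hQ : 0 ≤ Q) (hba : b ≤ a) (h : a + b + c + (x + y + z) + Q ≤ 1) :
    a * (4 - 4 * (a + b + c) - 3 * (x + y + z) - 4 * Q) ≤
      3 - 3 / 2 * Q - 4 * (a + b + c) - 2 * (x + y + z) +
      2 / 9 * ((4 * a + 2 * x - 1) ^ 2 + (4 * b + 2 * y - 1) ^ 2 + (4 * c + 2 * z - 1) ^ 2) +
      2 * (a + b + c) ^ 2 - 2 * (a ^ 2 + b ^ 2 + c ^ 2) := by
  have h2 := sub_nonneg.2 h
  have h3 := sub_nonneg.2 hba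
  linarith [mul_nonneg h3 hx, mul_nonneg hb hy, mul_nonneg hc hz, mul_nonneg hx h2,
    mul_nonneg hy hQ, mul_nonneg hy h2, mul_nonneg hz hQ, mul_nonneg hz h2, mul_nonneg hQ h2,
    sq_nonneg (-91 + 116 * a + 76 * b + 76 * c + 126 * x + 67 * y + 98 * z + 152 * Q),
    sq_nonneg (-2363 - 1780 * a + 6156 * b - 8892 * c + 9118 * x + 13311 * y + 5994 * z),
    sq_nonneg (-716705 + 629208 * a + 321422 * b + 859860 * c + 807100 * y + 739350 * z),
    sq_nonneg (15625 - 2935368 * a - 5376582 * b + 436676 * c + 5979490 * z),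
    sq_nonneg (-9486660 + 17985188 * a + 11892347 * b + 13693696 * c),
    sq_nonneg (-155345140 + 200425044 * a + 329905471 * b),
    sq_nonneg (-876453171 + 2284711360 * a)]

/-- Tangent line bound in `X`, and a quadratic minorant in `Y`, at the point `X = Y = 1`. -/
theorem inv_mul_ge {X Y : ℝ} (hX : 0 < X) (hY : 0 < Y) (hY4 : Y ≤ 4) :
    3 - X - Y + 2 / 9 * (Y - 1) ^ 2 ≤ (X * Y)⁻¹ := by
  obtain ⟨z, hz, rfl⟩ : ∃ z : ℝ, 0 < z ∧ z ^ 2 = Y := ⟨√Y, Real.sqrt_pos.2 hY, Real.sq_sqrt hY.le⟩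
  have hz2 : z ≤ 2 := by nlinarith
  have h1 : 2 / z - X ≤ (X * z ^ 2)⁻¹ := by
    have : (X * z ^ 2)⁻¹ - (2 / z - X) = (X * z - 1) ^ 2 / (X * z ^ 2) := by field_simp; ring
    have : 0 ≤ (X * z - 1) ^ 2 / (X * z ^ 2) := by positivity
    linarith
  have h2 : 3 - z ^ 2 + 2 / 9 * (z ^ 2 - 1) ^ 2 ≤ 2 / z := by
    have : 2 / z - (3 - z ^ 2 + 2 / 9 * (z ^ 2 - 1) ^ 2) =
        (z - 1) ^ 2 * (2 - z) * (2 * z ^ 2 + 8 * z + 9) / (9 * z) := by field_simp; ring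
    have : 0 ≤ (z - 1) ^ 2 * (2 - z) * (2 * z ^ 2 + 8 * z + 9) / (9 * z) := by
      have := sub_nonneg.2 hz2
      positivity
    linarith
  linarith

theorem quad_nonneg {a b c x y z Q p q r : ℝ} (ha : 0 ≤ a) (hb : 0 ≤ b) (hc : 0 ≤ c)
    (hx : 0 ≤ x) (hy : 0 ≤ y) (hz : 0 ≤ z) (hQ : 0 ≤ Q) (hp : 0 ≤ p) (hq : 0 ≤ q) (hr : 0 ≤ r)
    (h : a + b + c + (x + y + z) + Q ≤ 1)
    (hpqr : p + q + r + 4 * (a + b + c) + 3 * (x + y + z) + 4 * Q ≤ 4) :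
    a * p + b * q + c * r ≤ 3 - 3 / 2 * Q - 4 * (a + b + c) - 2 * (x + y + z) +
      2 / 9 * ((4 * a + 2 * x - 1) ^ 2 + (4 * b + 2 * y - 1) ^ 2 + (4 * c + 2 * z - 1) ^ 2) +
      2 * (a + b + c) ^ 2 - 2 * (a ^ 2 + b ^ 2 + c ^ 2) := by
  have key (m : ℝ) (hm : 0 ≤ m) (h1 : a ≤ m) (h2 : b ≤ m) (h3 : c ≤ m) :
      a * p + b * q + c * r ≤
        m * (4 - 4 * (a + b + c) - 3 * (x + y + z) - 4 * Q) := by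
    nlinarith [mul_le_mul_of_nonneg_right h1 hp, mul_le_mul_of_nonneg_right h2 hq,
      mul_le_mul_of_nonneg_right h3 hr, mul_le_mul_of_nonneg_left hpqr hm]
  rcases le_total b a with hba | hab
  · rcases le_total c a with hca | hac
    · linarith [key a ha le_rfl hba hca, quad_max hb hc hx hy hz hQ hba h]
    · linarith [key c hc hac (hba.trans hac) le_rfl,
        quad_max ha hb hz hx hy hQ hac (by linarith)]
  · rcases le_total c b with hcb | hbc
    · linarith [key b hb hab le_rfl hcb,
        quad_max ha hc hy hx hz hQ hab (by linarith)]
    · linarith [key c hc (hab.trans hbc) hbc le_rfl,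
        quad_max ha hb hz hx hy hQ (hab.trans hbc) (by linarith)]

section Graph

open Finset

variable {V : Type*} (G : SimpleGraph V) [DecidableRel G.Adj]

/-- The pattern of adjacencies from `x` to a labelled hexagon. -/
def trace (v : Fin 6 → V) (x : V) : Fin 6 → Bool := fun i => decide (G.Adj x (v i))

/-- Exchange the path `0, 1, 2, 3` of the hexagon with the third path of the theta graph. -/
def swapFirst (t : (Fin 6 → V) × (V × V)) : (Fin 6 → V) × (V × V) :=
  (![t.1 0, t.2.2, t.2.1, t.1 3, t.1 4, t.1 5], t.1 2, t.1 1)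

/-- Exchange the path `3, 4, 5, 0` of the hexagon with the third path of the theta graph. -/
def swapLast (t : (Fin 6 → V) × (V × V)) : (Fin 6 → V) × (V × V) :=
  (![t.1 0, t.1 1, t.1 2, t.1 3, t.2.1, t.2.2], t.1 4, t.1 5)

variable {G}

theorem trace_swapFirst (t : (Fin 6 → V) × (V × V)) (g : V) :
    trace G (swapFirst t).1 g = ![trace G t.1 g 0, decide (G.Adj g t.2.2),
      decide (G.Adj g t.2.1), trace G t.1 g 3, trace G t.1 g 4, trace G t.1 g 5] := by
  funext i; fin_cases i <;> rfl

theorem trace_swapLast (t : (Fin 6 → V) × (V × V)) (g : V) :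
    trace G (swapLast t).1 g = ![trace G t.1 g 0, trace G t.1 g 1, trace G t.1 g 2,
      trace G t.1 g 3, decide (G.Adj g t.2.1), decide (G.Adj g t.2.2)] := by
  funext i; fin_cases i <;> rfl

theorem swapFirst_swapFirst (t : (Fin 6 → V) × (V × V)) : swapFirst (swapFirst t) = t := by
  refine Prod.ext (funext fun i => ?_) rfl
  fin_cases i <;> rfl

theorem swapLast_swapLast (t : (Fin 6 → V) × (V × V)) : swapLast (swapLast t) = t := by
  refine Prod.ext (funext fun i => ?_) rfl
  fin_cases i <;> rfl

variable [Fintype V] (G)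

/-- The ordered pairs of adjacent vertices. -/
def darts : Finset (V × V) := univ.filter fun g => G.Adj g.1 g.2

/-- The labelled induced six-cycles. -/
def hexagons : Finset (Fin 6 → V) :=
  univ.filter fun v => ∀ i j, G.Adj (v i) (v j) ↔ (SimpleGraph.cycleGraph 6).Adj i j

/-- The number of darts, weighted by `f` of the patterns of their ends. -/
def total (f : (Fin 6 → Bool) → (Fin 6 → Bool) → ℕ) (v : Fin 6 → V) : ℕ :=
  ∑ g ∈ darts G, f (trace G v g.1) (trace G v g.2)

variable {G}

theorem mem_hexagons {v : Fin 6 → V} : v ∈ hexagons G ↔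
    ∀ i j, G.Adj (v i) (v j) ↔ (SimpleGraph.cycleGraph 6).Adj i j := by
  simp [hexagons]

theorem mem_darts {g : V × V} : g ∈ darts G ↔ G.Adj g.1 g.2 := by simp [darts]

theorem sum_darts_swap {α : Type*} [AddCommMonoid α] (f : V × V → α) :
    ∑ g ∈ darts G, f g.swap = ∑ g ∈ darts G, f g :=
  sum_nbij' Prod.swap Prod.swap (by simp [mem_darts, G.adj_comm]) (by simp [mem_darts, G.adj_comm])
    (by simp) (by simp) (by simp)

theorem total_swap (f : (Fin 6 → Bool) → (Fin 6 → Bool) → ℕ) (v : Fin 6 → V) :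
    total G (fun p q => f q p) v = total G f v :=
  sum_darts_swap fun g => f (trace G v g.1) (trace G v g.2)

theorem total_rot (f : (Fin 6 → Bool) → (Fin 6 → Bool) → ℕ) (k : Fin 6) (v : Fin 6 → V) :
    total G f (rot k v) = total G (fun p q => f (rot k p) (rot k q)) v := rfl

theorem rot_mem_hexagons (k : Fin 6) {v : Fin 6 → V} (hv : v ∈ hexagons G) :
    rot k v ∈ hexagons G := by
  rw [mem_hexagons] at *
  intro i j
  simp [rot, hv, SimpleGraph.cycleGraph_adj]

theorem sum_hexagons_rot {α : Type*} [AddCommMonoid α] (k : Fin 6) (f : (Fin 6 → V) → α) :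
    ∑ v ∈ hexagons G, f (rot k v) = ∑ v ∈ hexagons G, f v :=
  sum_nbij' (rot k) (rot (-k)) (fun _ h => rot_mem_hexagons k h) (fun _ h => rot_mem_hexagons _ h)
    (by intros; funext i; simp [rot]) (by intros; funext i; simp [rot]) (by simp)

theorem injective_of_mem_hexagons {v : Fin 6 → V} (hv : v ∈ hexagons G) :
    Function.Injective v := by
  intro i j h
  have key : ∀ k, (SimpleGraph.cycleGraph 6).Adj i k ↔ (SimpleGraph.cycleGraph 6).Adj j k :=
    fun k => by rw [← mem_hexagons.1 hv, ← mem_hexagons.1 hv, h]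
  simp only [SimpleGraph.cycleGraph_adj] at key
  clear h
  revert i j; decide

theorem first_mem_darts {v : Fin 6 → V} (hv : v ∈ hexagons G) : (v 0, v 1) ∈ darts G := by
  simp only [mem_darts, mem_hexagons.1 hv, SimpleGraph.cycleGraph_adj]
  decide

/-- Candidates for the second edge of a hexagon starting with `a, b`. -/
def secondEdges (G : SimpleGraph V) [DecidableRel G.Adj] (a b : V) : Finset (V × V) :=
  (darts G).filter fun g => G.Adj g.1 b ∧ ¬ G.Adj g.1 a ∧ ¬ G.Adj g.2 a ∧ ¬ G.Adj g.2 b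

/-- Candidates for the last edge of a hexagon starting with `a, b, c, d`. -/
def lastEdges (G : SimpleGraph V) [DecidableRel G.Adj] (a b c d : V) : Finset (V × V) :=
  (darts G).filter fun g => G.Adj g.1 d ∧ G.Adj g.2 a ∧ ¬ G.Adj g.1 a ∧ ¬ G.Adj g.1 b ∧
    ¬ G.Adj g.1 c ∧ ¬ G.Adj g.2 b ∧ ¬ G.Adj g.2 c ∧ ¬ G.Adj g.2 d

theorem total_extending (v : Fin 6 → V) :
    total G extending v = (secondEdges G (v 0) (v 1)).card := by
  rw [secondEdges, card_filter]
  refine sum_congr rfl fun g _ => ?_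
  simp [extending, trace, Bool.toNat, Bool.cond_eq_ite, and_assoc]

theorem total_closing (v : Fin 6 → V) :
    total G closing v = (lastEdges G (v 0) (v 1) (v 2) (v 3)).card := by
  rw [lastEdges, card_filter]
  refine sum_congr rfl fun g _ => ?_
  simp [closing, trace, Bool.toNat, Bool.cond_eq_ite, and_assoc]

theorem mem_secondEdges {v : Fin 6 → V} (hv : v ∈ hexagons G) :
    (v 2, v 3) ∈ secondEdges G (v 0) (v 1) := by
  simp only [secondEdges, mem_filter, mem_darts, mem_hexagons.1 hv,
    SimpleGraph.cycleGraph_adj]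
  decide

theorem mem_lastEdges {v : Fin 6 → V} (hv : v ∈ hexagons G) :
    (v 4, v 5) ∈ lastEdges G (v 0) (v 1) (v 2) (v 3) := by
  simp only [lastEdges, mem_filter, mem_darts, mem_hexagons.1 hv,
    SimpleGraph.cycleGraph_adj]
  decide

theorem total_extending_pos {v : Fin 6 → V} (hv : v ∈ hexagons G) : 0 < total G extending v := by
  rw [total_extending]; exact card_pos.2 ⟨_, mem_secondEdges hv⟩

theorem total_closing_pos {v : Fin 6 → V} (hv : v ∈ hexagons G) : 0 < total G closing v := by
  rw [total_closing]; exact card_pos.2 ⟨_, mem_lastEdges hv⟩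

theorem sum_const_inv_card_le {α : Type*} (s : Finset α) {x : ℝ} (hx : 0 ≤ x) :
    ∑ _i ∈ s, x * (s.card : ℝ)⁻¹ ≤ x := by
  rw [sum_const, nsmul_eq_mul]
  rcases s.eq_empty_or_nonempty with rfl | h
  · simpa using hx
  · have : (s.card : ℝ) ≠ 0 := by exact_mod_cast h.card_pos.ne'
    field_simp; rfl

theorem sum_inv_extending_mul_closing_le :
    ∑ v ∈ hexagons G, ((total G extending v : ℝ) * total G closing v)⁻¹ ≤ (darts G).card := by
  classical
  set T := (darts G).sigma fun e => (secondEdges G e.1 e.2).sigma fun f =>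
    lastEdges G e.1 e.2 f.1 f.2 with hT
  let w : ((_ : V × V) × (_ : V × V) × (V × V)) → ℝ := fun t =>
    ((secondEdges G t.1.1 t.1.2).card : ℝ)⁻¹ *
      ((lastEdges G t.1.1 t.1.2 t.2.1.1 t.2.1.2).card : ℝ)⁻¹
  let φ : (Fin 6 → V) → ((_ : V × V) × (_ : V × V) × (V × V)) := fun v =>
    ⟨(v 0, v 1), (v 2, v 3), (v 4, v 5)⟩
  have hφ : Set.InjOn φ (hexagons G) := by
    intro u _ v _ h
    simp only [φ, Sigma.mk.injEq, Prod.mk.injEq, heq_eq_eq] at h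
    funext i
    fin_cases i <;> simp_all
  calc _ = ∑ v ∈ hexagons G, w (φ v) := by
        refine sum_congr rfl fun v _ => ?_
        rw [total_extending, total_closing, mul_inv]
    _ = ∑ t ∈ (hexagons G).image φ, w t := (sum_image hφ).symm
    _ ≤ ∑ t ∈ T, w t := by
        refine sum_le_sum_of_subset_of_nonneg ?_ fun t _ _ => by positivity
        intro t ht
        obtain ⟨v, hv, rfl⟩ := mem_image.1 ht
        simp only [hT, φ, mem_sigma]
        exact ⟨first_mem_darts hv, mem_secondEdges hv, mem_lastEdges hv⟩
    _ = ∑ e ∈ darts G, ∑ f ∈ secondEdges G e.1 e.2, ∑ g ∈ lastEdges G e.1 e.2 f.1 f.2,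
          ((secondEdges G e.1 e.2).card : ℝ)⁻¹ * ((lastEdges G e.1 e.2 f.1 f.2).card : ℝ)⁻¹ := by
        rw [hT, sum_sigma]
        refine sum_congr rfl fun e _ => ?_
        rw [sum_sigma]
    _ ≤ ∑ e ∈ darts G, ∑ f ∈ secondEdges G e.1 e.2, 1 * ((secondEdges G e.1 e.2).card : ℝ)⁻¹ := by
        gcongr
        rw [one_mul]
        exact sum_const_inv_card_le _ (by positivity)
    _ ≤ ∑ e ∈ darts G, 1 := sum_le_sum fun e _ => sum_const_inv_card_le _ zero_le_one
    _ = _ := by simp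

theorem bridging_eq_one_iff (p q : Fin 6 → Bool) :
    bridging p q = 1 ↔ (∀ i, p i = true ↔ i = 3) ∧ ∀ i, q i = true ↔ i = 0 := by
  simp only [bridging, Bool.toNat_eq_one, Fin.forall_fin_succ, Fin.forall_fin_zero]
  simp [Fin.ext_iff]
  tauto

theorem bridging_le_one (p q : Fin 6 → Bool) : bridging p q ≤ 1 := Bool.toNat_le _

/-- The induced theta graphs made of a hexagon `v` and a path of length three between its
opposite vertices `v 3` and `v 0`. -/
def thetas (G : SimpleGraph V) [DecidableRel G.Adj] : Finset ((Fin 6 → V) × (V × V)) :=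
  (hexagons G ×ˢ darts G).filter fun t => bridging (trace G t.1 t.2.1) (trace G t.1 t.2.2) = 1

theorem mem_thetas {v : Fin 6 → V} {x y : V} : (v, x, y) ∈ thetas G ↔
    v ∈ hexagons G ∧ G.Adj x y ∧ (∀ i, G.Adj x (v i) ↔ i = 3) ∧ ∀ i, G.Adj y (v i) ↔ i = 0 := by
  simp [thetas, bridging_eq_one_iff, trace, mem_darts, and_assoc]

theorem sum_thetas (f : (Fin 6 → V) → ℕ) :
    ∑ t ∈ thetas G, f t.1 = ∑ v ∈ hexagons G, total G bridging v * f v := by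
  rw [thetas, sum_filter, sum_product]
  refine sum_congr rfl fun v _ => ?_
  rw [total, sum_mul]
  refine sum_congr rfl fun g _ => ?_
  have := bridging_le_one (trace G v g.1) (trace G v g.2)
  interval_cases bridging (trace G v g.1) (trace G v g.2) <;> simp

theorem swapFirst_mem {t : (Fin 6 → V) × (V × V)} (ht : t ∈ thetas G) :
    swapFirst t ∈ thetas G := by
  obtain ⟨v, x, y⟩ := t
  obtain ⟨hv, hxy, hx, hy⟩ := mem_thetas.1 ht
  rw [mem_hexagons] at hv
  have hx' i : G.Adj (v i) x ↔ i = 3 := by rw [G.adj_comm, hx]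
  have hy' i : G.Adj (v i) y ↔ i = 0 := by rw [G.adj_comm, hy]
  refine mem_thetas.2 ⟨mem_hexagons.2 fun i j => ?_, ?_, fun i => ?_, fun i => ?_⟩
  · fin_cases i <;> fin_cases j <;>
      simp [hv, hx, hy, hx', hy', hxy, hxy.symm, SimpleGraph.cycleGraph_adj] <;> decide
  · simp [hv, SimpleGraph.cycleGraph_adj]
  · fin_cases i <;> simp [hv, hx', hy', SimpleGraph.cycleGraph_adj]
    decide
  · fin_cases i <;> simp [hv, hx', hy', SimpleGraph.cycleGraph_adj]

theorem swapLast_mem {t : (Fin 6 → V) × (V × V)} (ht : t ∈ thetas G) :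
    swapLast t ∈ thetas G := by
  obtain ⟨v, x, y⟩ := t
  obtain ⟨hv, hxy, hx, hy⟩ := mem_thetas.1 ht
  rw [mem_hexagons] at hv
  have hx' i : G.Adj (v i) x ↔ i = 3 := by rw [G.adj_comm, hx]
  have hy' i : G.Adj (v i) y ↔ i = 0 := by rw [G.adj_comm, hy]
  refine mem_thetas.2 ⟨mem_hexagons.2 fun i j => ?_, ?_, fun i => ?_, fun i => ?_⟩
  · fin_cases i <;> fin_cases j <;>
      simp [hv, hx, hy, hx', hy', hxy, hxy.symm, SimpleGraph.cycleGraph_adj] <;> decide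
  · simp [hv, SimpleGraph.cycleGraph_adj]
  · fin_cases i <;> simp [hv, hx', hy', SimpleGraph.cycleGraph_adj]
    decide
  · fin_cases i <;> simp [hv, hx', hy', SimpleGraph.cycleGraph_adj]
    decide

theorem sum_thetas_swapFirst (f : (Fin 6 → V) → ℕ) :
    ∑ t ∈ thetas G, f (swapFirst t).1 = ∑ t ∈ thetas G, f t.1 :=
  sum_nbij' swapFirst swapFirst (fun _ => swapFirst_mem) (fun _ => swapFirst_mem)
    (fun _ _ => swapFirst_swapFirst _) (fun _ _ => swapFirst_swapFirst _) fun _ _ => rfl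

theorem sum_thetas_swapLast (f : (Fin 6 → V) → ℕ) :
    ∑ t ∈ thetas G, f (swapLast t).1 = ∑ t ∈ thetas G, f t.1 :=
  sum_nbij' swapLast swapLast (fun _ => swapLast_mem) (fun _ => swapLast_mem)
    (fun _ _ => swapLast_swapLast _) (fun _ _ => swapLast_swapLast _) fun _ _ => rfl

theorem sum_bridging_mul_crossing_le :
    2 * ∑ v ∈ hexagons G, total G bridging v * total G crossing v ≤
      ∑ v ∈ hexagons G, total G bridging v * total G penalty v := by
  have key (t : (Fin 6 → V) × (V × V)) :
      2 * (total G crossing t.1 + total G crossing (swapLast t).1 +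
        total G crossing (swapFirst t).1) ≤
      total G penalty t.1 + total G penalty (swapLast t).1 + total G penalty (swapFirst t).1 := by
    simp only [total, trace_swapFirst, trace_swapLast, ← sum_add_distrib, mul_sum]
    exact sum_le_sum fun g _ => crossing_theta_le _ _ _ _ _ _
  have := sum_le_sum fun t (_ : t ∈ thetas G) => key t
  simp only [← mul_sum, sum_add_distrib, sum_thetas_swapFirst, sum_thetas_swapLast,
    sum_thetas] at this
  omega

theorem sum_total_rot (f : (Fin 6 → Bool) → (Fin 6 → Bool) → ℕ) (v : Fin 6 → V) :
    ∑ g ∈ darts G, ∑ k, f (rot k (trace G v g.1)) (rot k (trace G v g.2)) =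
      ∑ k, total G f (rot k v) := sum_comm

theorem sum_total_rot_swap (f : (Fin 6 → Bool) → (Fin 6 → Bool) → ℕ) (v : Fin 6 → V) :
    ∑ g ∈ darts G, ∑ k, f (rot k (trace G v g.2)) (rot k (trace G v g.1)) =
      ∑ k, total G f (rot k v) := by
  rw [← sum_total_rot, ← sum_darts_swap]; rfl

theorem total_extending_le (v : Fin 6 → V) :
    2 * ∑ k, total G extending (rot k v) ≤ 2 * (darts G).card + total G alternating v := by
  have := sum_le_sum fun g (_ : g ∈ darts G) =>
    extending_sum_le (trace G v g.1) (trace G v g.2)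
  simp only [sum_add_distrib, sum_total_rot, sum_total_rot_swap, sum_const, smul_eq_mul] at this
  rw [total]
  omega

theorem total_closing_le (v : Fin 6 → V) :
    2 * ∑ k, total G closing (rot k v) + total G alternating v ≤
      (darts G).card + ∑ k, total G bridging (rot k v) := by
  have := sum_le_sum fun g (_ : g ∈ darts G) =>
    closing_sum_le (trace G v g.1) (trace G v g.2)
  simp only [sum_add_distrib, sum_total_rot, sum_total_rot_swap, sum_const, smul_eq_mul] at this
  simp only [total] at this ⊢
  omega

theorem total_penalty_le (v : Fin 6 → V) :
    total G penalty v + total G penalty (rot 1 v) + total G penalty (rot 2 v) +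
      6 * ∑ k, total G closing (rot k v) + 4 * total G alternating v ≤
      4 * (darts G).card + 2 * ∑ k, total G bridging (rot k v) := by
  have := sum_le_sum fun g (_ : g ∈ darts G) =>
    penalty_sum_le (trace G v g.1) (trace G v g.2)
  simp only [sum_add_distrib, ← mul_sum, sum_total_rot, sum_total_rot_swap, sum_const,
    smul_eq_mul] at this
  rw [total_rot, total_rot]
  simp only [total] at this ⊢
  omega

theorem total_bridging_le (v : Fin 6 → V) : total G bridging v ≤ total G closing v :=
  sum_le_sum fun _ _ => bridging_le_closing _ _

theorem two_mul_total_closing_le (v : Fin 6 → V) :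
    2 * total G closing v ≤ (darts G).card := by
  have := sum_le_sum fun g (_ : g ∈ darts G) =>
    closing_add_swap_le (trace G v g.1) (trace G v g.2)
  rw [sum_add_distrib, sum_const, smul_eq_mul, mul_one] at this
  have h := total_swap (G := G) closing v
  simp only [total] at h ⊢
  omega

theorem total_bridging_rot_three (v : Fin 6 → V) :
    total G bridging (rot 3 v) = total G bridging v := by
  rw [total_rot, ← total_swap]
  exact sum_congr rfl fun _ _ => bridging_swap _ _

theorem rot_rot {α : Type*} (k l : Fin 6) (v : Fin 6 → α) : rot k (rot l v) = rot (k + l) v := by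
  funext i; simp [rot, add_assoc]

theorem rot_zero {α : Type*} (v : Fin 6 → α) : rot 0 v = v := by
  funext i; simp [rot]

theorem total_crossing (v : Fin 6 → V) :
    total G crossing v = 2 * (total G bridging (rot 1 v) + total G bridging (rot 2 v)) := by
  have h1 := total_bridging_rot_three (G := G) (rot 1 v)
  have h2 := total_bridging_rot_three (G := G) (rot 2 v)
  rw [rot_rot] at h1 h2
  have : total G crossing v = total G bridging (rot 1 v) + total G bridging (rot (3 + 1) v) +
      (total G bridging (rot 2 v) + total G bridging (rot (3 + 2) v)) := by
    simp only [total, ← sum_add_distrib]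
    rfl
  omega


theorem six_le_of_constraints {t₀ t₁ t₂ f₀ f₁ f₂ f₃ f₄ f₅ E Q p q r : ℝ}
    (h₀ : 0 ≤ t₀) (h₁ : 0 ≤ t₁) (h₂ : 0 ≤ t₂) (g₀ : t₀ ≤ f₀) (g₁ : t₁ ≤ f₁) (g₂ : t₂ ≤ f₂)
    (g₃ : t₀ ≤ f₃) (g₄ : t₁ ≤ f₄) (g₅ : t₂ ≤ f₅) (hQ : 0 ≤ Q) (hp : 0 ≤ p) (hq : 0 ≤ q)
    (hr : 0 ≤ r) (hE : 2 * E ≤ 2 + Q)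
    (hf : 2 * (f₀ + f₁ + f₂ + f₃ + f₄ + f₅) + Q ≤ 1 + 2 * (t₀ + t₁ + t₂))
    (hpqr : p + q + r + 6 * (f₀ + f₁ + f₂ + f₃ + f₄ + f₅) + 4 * Q ≤ 4 + 4 * (t₀ + t₁ + t₂)) :
    6 ≤ 18 - 6 * E - 8 * (f₀ + f₁ + f₂ + f₃ + f₄ + f₅) +
      2 / 9 * ((8 * f₀ - 1) ^ 2 + (8 * f₁ - 1) ^ 2 + (8 * f₂ - 1) ^ 2 + (8 * f₃ - 1) ^ 2 +
        (8 * f₄ - 1) ^ 2 + (8 * f₅ - 1) ^ 2) +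
      4 * (t₀ * (4 * (t₁ + t₂) - p) + t₁ * (4 * (t₂ + t₀) - q) + t₂ * (4 * (t₀ + t₁) - r)) := by
  have := quad_nonneg (a := 2 * t₀) (b := 2 * t₁) (c := 2 * t₂) (x := 2 * (f₀ + f₃ - 2 * t₀))
    (y := 2 * (f₁ + f₄ - 2 * t₁)) (z := 2 * (f₂ + f₅ - 2 * t₂)) (by linarith) (by linarith)
    (by linarith) (by linarith) (by linarith) (by linarith) hQ hp hq hr (by linarith)
    (by linarith)
  linarith [sq_nonneg (f₀ - f₃), sq_nonneg (f₁ - f₄), sq_nonneg (f₂ - f₅)]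

/-- The tangent-type lower bound for the normalised inverse of
`total G extending v * total G closing v`. -/
noncomputable def weightBound (G : SimpleGraph V) [DecidableRel G.Adj] (v : Fin 6 → V) : ℝ :=
  3 - 6 * (total G extending v / (darts G).card) - 8 * (total G closing v / (darts G).card) +
    2 / 9 * (8 * (total G closing v / (darts G).card) - 1) ^ 2

/-- The correction term, which is nonpositive on average over hexagons. -/
noncomputable def correction (G : SimpleGraph V) [DecidableRel G.Adj] (v : Fin 6 → V) : ℝ :=
  total G bridging v / (darts G).card *
    ((2 * total G crossing v - total G penalty v) / (darts G).card)

theorem six_le_sum_weightBound (hM : 0 < (darts G).card) (v : Fin 6 → V) :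
    6 ≤ ∑ k, weightBound G (rot k v) +
      4 * (correction G v + correction G (rot 1 v) + correction G (rot 2 v)) := by
  have hM' : (0 : ℝ) < (darts G).card := by exact_mod_cast hM
  have b₃ := total_bridging_rot_three (G := G) v
  have b₄ := total_bridging_rot_three (G := G) (rot 1 v)
  have b₅ := total_bridging_rot_three (G := G) (rot 2 v)
  have c₀ := total_crossing (G := G) v
  have c₁ := total_crossing (G := G) (rot 1 v)
  have c₂ := total_crossing (G := G) (rot 2 v)
  have g₀ := total_bridging_le (G := G) v
  have g (k : Fin 6) := total_bridging_le (G := G) (rot k v)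
  have g₁ := g 1
  have g₂ := g 2
  have g₃ := g 3
  have g₄ := g 4
  have g₅ := g 5
  have hE := total_extending_le (G := G) v
  have hf := total_closing_le (G := G) v
  have hp := total_penalty_le (G := G) v
  simp only [rot_rot, Fin.reduceAdd, Fin.isValue] at b₄ b₅ c₁ c₂
  rw [b₃] at c₁ c₂ g₃
  rw [b₄] at c₂ g₄
  rw [b₅] at g₅
  simp only [Fin.sum_univ_six, rot_zero, b₃, b₄, b₅] at hf hp
  rify at *
  have key := six_le_of_constraints
    (t₀ := total G bridging v / (darts G).card)
    (t₁ := total G bridging (rot 1 v) / (darts G).card)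
    (t₂ := total G bridging (rot 2 v) / (darts G).card)
    (f₀ := total G closing v / (darts G).card)
    (f₁ := total G closing (rot 1 v) / (darts G).card)
    (f₂ := total G closing (rot 2 v) / (darts G).card)
    (f₃ := total G closing (rot 3 v) / (darts G).card)
    (f₄ := total G closing (rot 4 v) / (darts G).card)
    (f₅ := total G closing (rot 5 v) / (darts G).card)
    (E := (∑ k, (total G extending (rot k v) : ℝ)) / (darts G).card)
    (Q := total G alternating v / (darts G).card)
    (p := total G penalty v / (darts G).card)
    (q := total G penalty (rot 1 v) / (darts G).card)
    (r := total G penalty (rot 2 v) / (darts G).card)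
    (by positivity) (by positivity) (by positivity) (by gcongr) (by gcongr) (by gcongr)
    (by gcongr) (by gcongr) (by gcongr) (by positivity) (by positivity) (by positivity)
    (by positivity) (by field_simp; linarith) (by field_simp; linarith)
    (by field_simp; linarith)
  refine key.trans (le_of_eq ?_)
  simp only [Fin.sum_univ_six, weightBound, correction, rot_zero, c₀, c₁, c₂]
  ring

theorem weightBound_le (hM : 0 < (darts G).card) {v : Fin 6 → V} (hv : v ∈ hexagons G) :
    weightBound G v ≤
      (darts G).card ^ 2 / 48 * ((total G extending v : ℝ) * total G closing v)⁻¹ := by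
  have h1 : (0 : ℝ) < total G extending v := by exact_mod_cast total_extending_pos hv
  have h2 : (0 : ℝ) < total G closing v := by exact_mod_cast total_closing_pos hv
  have h3 : (2 : ℝ) * total G closing v ≤ (darts G).card := by
    exact_mod_cast two_mul_total_closing_le v
  have hM' : (0 : ℝ) < (darts G).card := by exact_mod_cast hM
  refine (inv_mul_ge (X := 6 * (total G extending v / (darts G).card))
    (Y := 8 * (total G closing v / (darts G).card)) (by positivity) (by positivity)
    (by field_simp; linarith)).trans (le_of_eq ?_)
  field_simp
  norm_num

theorem sum_correction_nonpos : ∑ v ∈ hexagons G, correction G v ≤ 0 := by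
  have h : (2 : ℝ) * ∑ v ∈ hexagons G, (total G bridging v : ℝ) * total G crossing v ≤
      ∑ v ∈ hexagons G, (total G bridging v : ℝ) * total G penalty v := by
    exact_mod_cast sum_bridging_mul_crossing_le (G := G)
  have : ∑ v ∈ hexagons G, correction G v =
      (2 * ∑ v ∈ hexagons G, (total G bridging v : ℝ) * total G crossing v -
        ∑ v ∈ hexagons G, (total G bridging v : ℝ) * total G penalty v) /
        ((darts G).card : ℝ) ^ 2 := by
    rw [mul_sum, ← sum_sub_distrib, sum_div]
    refine sum_congr rfl fun v _ => ?_
    rw [correction, div_mul_div_comm]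
    ring
  rw [this]
  exact div_nonpos_of_nonpos_of_nonneg (by linarith) (by positivity)

/-- There are at most `M ^ 3 / 48` labelled induced six-cycles in a graph with `M` darts. -/
theorem card_hexagons_le : ((hexagons G).card : ℝ) ≤ (darts G).card ^ 3 / 48 := by
  rcases (hexagons G).eq_empty_or_nonempty with h | ⟨v, hv⟩
  · rw [h, card_empty, Nat.cast_zero]
    positivity
  have hM : 0 < (darts G).card := card_pos.2 ⟨_, first_mem_darts hv⟩
  have h1 := sum_le_sum fun v (_ : v ∈ hexagons G) => six_le_sum_weightBound hM v
  rw [sum_add_distrib, ← mul_sum, sum_comm] at h1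
  simp only [sum_add_distrib, sum_hexagons_rot _ (weightBound G),
    sum_hexagons_rot _ (correction G), sum_const, nsmul_eq_mul, card_univ, Fintype.card_fin] at h1
  have h2 := sum_le_sum fun v (hv : v ∈ hexagons G) => weightBound_le hM hv
  rw [← mul_sum] at h2
  have h3 := mul_le_mul_of_nonneg_left (sum_inv_extending_mul_closing_le (G := G))
    (by positivity : (0 : ℝ) ≤ ((darts G).card : ℝ) ^ 2 / 48)
  have h4 := sum_correction_nonpos (G := G)
  push_cast at h1
  linarith

theorem card_darts : (darts G).card = 2 * G.edgeFinset.card := by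
  rw [← SimpleGraph.sum_degrees_eq_twice_card_edges, darts, ← univ_product_univ, card_filter,
    sum_product]
  refine sum_congr rfl fun v _ => ?_
  rw [← card_filter, ← SimpleGraph.card_neighborFinset_eq_degree,
    SimpleGraph.neighborFinset_eq_filter]

/-- The twelve relabellings of a hexagon. -/
def reindex (s : Fin 6 × Bool) (i : Fin 6) : Fin 6 := bif s.2 then s.1 + i else s.1 - i

theorem reindex_injective : Function.Injective reindex := by
  have h : ∀ s t : Fin 6 × Bool,
      reindex s 0 = reindex t 0 → reindex s 1 = reindex t 1 → s = t := by decide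
  exact fun s t hst => h s t (by rw [hst]) (by rw [hst])

theorem cycleGraph_adj_reindex (s : Fin 6 × Bool) (i j : Fin 6) :
    (SimpleGraph.cycleGraph 6).Adj (reindex s i) (reindex s j) ↔
      (SimpleGraph.cycleGraph 6).Adj i j := by
  simp only [SimpleGraph.cycleGraph_adj]
  revert s i j
  decide

theorem twelve_mul_inducedCopies_le :
    12 * inducedCopies G (SimpleGraph.cycleGraph 6) ≤ (hexagons G).card := by
  classical
  rw [inducedCopies, Set.ncard_eq_toFinset_card']
  set A := {S : Finset V | Nonempty (G.induce (S : Set V) ≃g SimpleGraph.cycleGraph 6)}.toFinset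
    with hA
  have hS (S : A) : ∃ f : Fin 6 → V, f ∈ hexagons G ∧ univ.image f = S := by
    obtain ⟨S, h⟩ := S
    obtain ⟨e⟩ : Nonempty (G.induce (S : Set V) ≃g SimpleGraph.cycleGraph 6) := by
      simpa [hA] using h
    refine ⟨fun i => (e.symm i : V), mem_hexagons.2 fun i j => e.symm.map_rel_iff, ?_⟩
    ext x
    simp only [mem_image, mem_univ, true_and]
    constructor
    · rintro ⟨i, rfl⟩
      exact (e.symm i).2
    · exact fun hx => ⟨e ⟨x, hx⟩, by simp⟩
  choose f hf hfS using hS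
  have hcard : 12 * A.card = (univ : Finset (A × Fin 6 × Bool)).card := by
    simp [mul_comm]
  rw [hcard]
  refine card_le_card_of_injOn (fun t i => f t.1 (reindex t.2 i)) ?_ ?_
  · rintro ⟨S, s⟩ -
    refine mem_hexagons.2 fun i j => ?_
    rw [mem_hexagons.1 (hf S), cycleGraph_adj_reindex]
  · rintro ⟨S, s⟩ - ⟨T, t⟩ - h
    have hsurj : ∀ r : Fin 6 × Bool, univ.image (reindex r) = univ := by decide
    have himg (R : A) (r : Fin 6 × Bool) : univ.image (f R ∘ reindex r) = R := by
      rw [← image_image, hsurj, hfS]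
    have hST : S = T := by
      rw [Subtype.ext_iff, ← himg S s, ← himg T t]
      exact congrArg (fun g => univ.image g) h
    subst hST
    exact congrArg (S, ·) <| reindex_injective <| funext fun i =>
      injective_of_mem_hexagons (hf S) (congrFun h i)

end Graph

end SixCycle

theorem six_cycle_upper_bound {V : Type*} [Fintype V] (G : SimpleGraph V) (m : ℕ)
    (hG : G.edgeSet.ncard = m) :
    (inducedCopies G (SimpleGraph.cycleGraph 6) : ℝ) ≤ 3 * ((m : ℝ) / 6) ^ 3 := by
  classical
  have h1 := SixCycle.twelve_mul_inducedCopies_le (G := G)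
  rify at h1
  have h2 := SixCycle.card_hexagons_le (G := G)
  have h3 : (SixCycle.darts G).card = 2 * m := by
    rw [SixCycle.card_darts, ← hG, ← SimpleGraph.coe_edgeFinset, Set.ncard_coe_finset]
  rw [h3] at h2
  push_cast at h2
  linarith
end

section
/- Let l ≥ 4 be an integer. Then every finite simple graph G with exactly m edges contains at most (m/(2l))^l · (1 + 1/(l−1))^{l−1} induced copies of the cycle C_{2l} on 2l vertices; in particular it contains at most e · (m/(2l))^l induced copies of C_{2l}. -/
open SimpleGraph

/-- `G` induces the cycle `c 0, c 1, …, c (n - 1)`. -/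
def IsInducedCycle {V : Type*} (G : SimpleGraph V) {n : ℕ} (c : ZMod n → V) : Prop :=
  Function.Injective c ∧ ∀ i j, G.Adj (c i) (c j) ↔ i = j + 1 ∨ j = i + 1

/-- The `i`-th edge, oriented, of the perfect matching `c 0 c 1, c 2 c 3, …` of a cycle `c`. -/
def matchingDart {V : Type*} {n : ℕ} (c : ZMod n → V) (i : ℕ) : V × V :=
  (c ((2 * i : ℕ) : ZMod n), c ((2 * i + 1 : ℕ) : ZMod n))

open Classical in
/-- The oriented edges of `G` that look, from the first `i` matching edges `p` of an induced
`2l`-cycle, like the next matching edge of that cycle. -/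
noncomputable def extensions {V : Type*} [Fintype V] (G : SimpleGraph V) (l i : ℕ)
    (p : Fin i → V × V) : Finset (V × V) :=
  Finset.univ.filter fun d => G.Adj d.1 d.2 ∧ ∀ j : Fin i,
    ¬ G.Adj d.1 (p j).1 ∧ (G.Adj d.1 (p j).2 ↔ (j : ℕ) + 1 = i) ∧
    (G.Adj d.2 (p j).1 ↔ i + 1 = l ∧ (j : ℕ) = 0) ∧ ¬ G.Adj d.2 (p j).2

/-- A vertex pair, adjacent to the cycle at the places `P` and `Q` respectively, is an extension
of the first `i` matching edges of the cycle started at `s`. -/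
def IsExtensionAt {n : ℕ} (l : ℕ) (P Q : ZMod n → Prop) (s : ZMod n) (i : ℕ) : Prop :=
  ∀ j < i, ¬ P (s + (2 * j : ℕ)) ∧ (P (s + (2 * j + 1 : ℕ)) ↔ j + 1 = i) ∧
    (Q (s + (2 * j : ℕ)) ↔ i + 1 = l ∧ j = 0) ∧ ¬ Q (s + (2 * j + 1 : ℕ))

/-- The first place from `s` on where `R` holds is at distance `2 * i - 1`. -/
def FirstAtOdd {n : ℕ} (R : ZMod n → Prop) (s : ZMod n) (i : ℕ) : Prop :=
  0 < i ∧ (∀ t < 2 * i - 1, ¬ R (s + (t : ℕ))) ∧ R (s + (2 * i - 1 : ℕ))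

/-- `R` holds at `s` and at `s + (2 * l - 3)`, but nowhere in between. -/
def LongGapAt {n : ℕ} (l : ℕ) (R : ZMod n → Prop) (s : ZMod n) : Prop :=
  R s ∧ (∀ t, 1 ≤ t → t < 2 * l - 3 → ¬ R (s + (t : ℕ))) ∧ R (s + (2 * l - 3 : ℕ))

theorem IsExtensionAt.firstAtOdd {n l i : ℕ} {P Q : ZMod n → Prop} {s : ZMod n}
    (h : IsExtensionAt l P Q s i) (hi : 0 < i) (hil : i + 1 ≠ l) :
    FirstAtOdd (fun t => P t ∨ Q t) s i := by
  refine ⟨hi, fun t ht => ?_, ?_⟩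
  · obtain ⟨j, rfl | rfl⟩ := Nat.even_or_odd' t
    · have := h j (by omega)
      tauto
    · have := h j (by omega)
      have hj : j + 1 ≠ i := by omega
      tauto
  · have := h (i - 1) (by omega)
    have e : 2 * (i - 1) + 1 = 2 * i - 1 := by omega
    rw [e] at this
    left
    exact this.2.1.2 (by omega)

theorem IsExtensionAt.longGapAt {n l i : ℕ} {P Q : ZMod n → Prop} {s : ZMod n}
    (h : IsExtensionAt l P Q s i) (hi : 0 < i) (hil : i + 1 = l) :
    LongGapAt l (fun t => P t ∨ Q t) s := by
  refine ⟨?_, fun t ht ht' => ?_, ?_⟩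
  · have := (h 0 hi).2.2.1.2 ⟨hil, rfl⟩
    right
    simpa using this
  · obtain ⟨j, rfl | rfl⟩ := Nat.even_or_odd' t
    · have := h j (by omega)
      have hj : j ≠ 0 := by omega
      tauto
    · have := h j (by omega)
      have hj : j + 1 ≠ i := by omega
      tauto
  · have := h (i - 1) (by omega)
    have e : 2 * (i - 1) + 1 = 2 * l - 3 := by omega
    rw [e] at this
    left
    exact this.2.1.2 (by omega)

theorem IsExtensionAt.not_swap {n l i : ℕ} {P Q : ZMod n → Prop} {s : ZMod n}
    (h : IsExtensionAt l P Q s i) (hi : 0 < i) : ¬ IsExtensionAt l Q P s i := by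
  intro h'
  have h₁ := h (i - 1) (by omega)
  have h₂ := h' (i - 1) (by omega)
  exact h₂.2.2.2 (h₁.2.1.2 (by omega))

theorem FirstAtOdd.unique {n i i' : ℕ} {R : ZMod n → Prop} {s : ZMod n}
    (h : FirstAtOdd R s i) (h' : FirstAtOdd R s i') : i = i' := by
  obtain ⟨hi, hn, hR⟩ := h
  obtain ⟨hi', hn', hR'⟩ := h'
  rcases lt_trichotomy i i' with hlt | heq | hlt
  · exact absurd hR (hn' _ (by omega))
  · exact heq
  · exact absurd hR' (hn _ (by omega))

theorem FirstAtOdd.not_succ {n i i' : ℕ} {R : ZMod n → Prop} {s : ZMod n}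
    (h : FirstAtOdd R s i) : ¬ FirstAtOdd R (s + 1) i' := by
  rintro ⟨hi', hn', hR'⟩
  obtain ⟨hi, hn, hR⟩ := h
  have shift : ∀ t : ℕ, s + 1 + (t : ZMod n) = s + ((t + 1 : ℕ) : ZMod n) := by
    intro t; push_cast; ring
  simp only [shift] at hn' hR'
  by_cases hlt : i ≤ i'
  · have := hn' (2 * i - 2) (by omega)
    rw [show 2 * i - 2 + 1 = 2 * i - 1 by omega] at this
    exact this hR
  · exact hn _ (by omega) hR'

theorem LongGapAt.not_firstAtOdd {n l i : ℕ} {R : ZMod n → Prop} {s : ZMod n}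
    (h : LongGapAt l R s) : ¬ FirstAtOdd R s i := by
  rintro ⟨hi, hn, -⟩
  have := hn 0 (by omega)
  simp only [Nat.cast_zero, add_zero] at this
  exact this h.1

theorem LongGapAt.not_firstAtOdd_succ {n l i : ℕ} (hl : 4 ≤ l) {R : ZMod n → Prop} {s : ZMod n}
    (h : LongGapAt l R s) : ¬ FirstAtOdd R (s + 1) i := by
  rintro ⟨hi, hn, hR⟩
  obtain ⟨-, hgap, hend⟩ := h
  have shift : ∀ t : ℕ, s + 1 + (t : ZMod n) = s + ((t + 1 : ℕ) : ZMod n) := by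
    intro t; push_cast; ring
  simp only [shift] at hn hR
  by_cases hlt : 2 * i - 1 < 2 * l - 4
  · exact hgap _ (by omega) (by omega) hR
  · have := hn (2 * l - 4) (by omega)
    rw [show 2 * l - 4 + 1 = 2 * l - 3 by omega] at this
    exact this hend

theorem LongGapAt.unique {l : ℕ} (hl : 4 ≤ l) {R : ZMod (2 * l) → Prop} {s s' : ZMod (2 * l)}
    (h : LongGapAt l R s) (h' : LongGapAt l R s') : s = s' := by
  have : NeZero (2 * l) := ⟨by omega⟩
  by_contra hne
  have hlt := ZMod.val_lt (s' - s)
  have hcast := ZMod.natCast_zmod_val (s' - s)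
  have hpos : (s' - s).val ≠ 0 := by
    rw [Ne, ZMod.val_eq_zero, sub_eq_zero]
    exact fun e => hne e.symm
  set k := (s' - s).val
  by_cases hk : k < 2 * l - 3
  · apply h.2.1 k (by omega) hk
    rw [hcast, add_sub_cancel]
    exact h'.1
  · apply h'.2.1 (2 * l - k) (by omega) (by omega)
    rw [Nat.cast_sub hlt.le, hcast, ZMod.natCast_self]
    convert h.1 using 1
    ring

open Classical in
theorem card_isExtensionAt_le {l : ℕ} (hl : 4 ≤ l) [NeZero (2 * l)] (P Q : ZMod (2 * l) → Prop) :
    (((Finset.univ : Finset (ZMod (2 * l))) ×ˢ Finset.Ico 1 l).filter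
      fun a => IsExtensionAt l P Q a.1 a.2).card +
    (((Finset.univ : Finset (ZMod (2 * l))) ×ˢ Finset.Ico 1 l).filter
      fun a => IsExtensionAt l Q P a.1 a.2).card ≤ l := by
  set R : ZMod (2 * l) → Prop := fun t => P t ∨ Q t with hR
  have hR' : R = fun t => Q t ∨ P t := by funext t; simp only [hR, or_comm]
  rw [← Finset.card_union_of_disjoint (by
    rw [Finset.disjoint_left]
    intro a ha hb
    simp only [Finset.mem_filter, Finset.mem_product, Finset.mem_Ico] at ha hb
    exact ha.2.not_swap (by omega) hb.2)]
  set U := (Finset.univ : Finset (ZMod (2 * l))) ×ˢ Finset.Ico 1 l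
  set A : Finset (ZMod (2 * l)) := Finset.univ.filter fun s => ∃ i, FirstAtOdd R s i with hA
  set B : Finset (ZMod (2 * l)) := Finset.univ.filter fun s => LongGapAt l R s with hB
  have hAB : ((U.filter fun a => IsExtensionAt l P Q a.1 a.2) ∪
      (U.filter fun a => IsExtensionAt l Q P a.1 a.2)).card ≤ A.card + B.card := by
    have hAB : Disjoint A B := by
      rw [Finset.disjoint_left]
      intro s hs hs'
      simp only [hA, hB, Finset.mem_filter, Finset.mem_univ, true_and] at hs hs'
      obtain ⟨i, hi⟩ := hs
      exact hs'.not_firstAtOdd hi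
    have key : ∀ a ∈ (U.filter fun a => IsExtensionAt l P Q a.1 a.2) ∪
        (U.filter fun a => IsExtensionAt l Q P a.1 a.2),
        (FirstAtOdd R a.1 a.2) ∨ (LongGapAt l R a.1 ∧ a.2 + 1 = l) := by
      intro a ha
      simp only [U, Finset.mem_union, Finset.mem_filter, Finset.mem_product, Finset.mem_Ico] at ha
      by_cases hal : a.2 + 1 = l
      · right
        refine ⟨?_, hal⟩
        rcases ha with ha | ha
        · exact ha.2.longGapAt (by omega) hal
        · rw [hR']; exact ha.2.longGapAt (by omega) hal
      · left
        rcases ha with ha | ha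
        · exact ha.2.firstAtOdd (by omega) hal
        · rw [hR']; exact ha.2.firstAtOdd (by omega) hal
    rw [← Finset.card_union_of_disjoint hAB]
    refine Finset.card_le_card_of_injOn Prod.fst ?_ ?_
    · intro a ha
      simp only [hA, hB, Finset.coe_union, Set.mem_union, Finset.mem_coe, Finset.mem_filter,
        Finset.mem_univ, true_and]
      rcases key a ha with h | h
      · exact Or.inl ⟨_, h⟩
      · exact Or.inr h.1
    · rintro ⟨s, i⟩ ha ⟨s', i'⟩ hb hab
      obtain rfl : s = s' := hab
      rcases key _ ha with h | h <;> rcases key _ hb with h' | h'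
      · exact Prod.ext rfl (h.unique h')
      · exact absurd h h'.1.not_firstAtOdd
      · exact absurd h' h.1.not_firstAtOdd
      · have h₁ : i + 1 = l := h.2
        have h₂ : i' + 1 = l := h'.2
        exact Prod.ext rfl (by change i = i'; omega)
  refine hAB.trans ?_
  have hB1 : B.card ≤ 1 := by
    rw [Finset.card_le_one]
    intro s hs s' hs'
    simp only [hB, Finset.mem_filter, Finset.mem_univ, true_and] at hs hs'
    exact hs.unique hl hs'
  set A' := A.map (Equiv.addRight (1 : ZMod (2 * l))).toEmbedding with hA'
  have hdisj : Disjoint A A' := by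
    rw [Finset.disjoint_left]
    intro s hs hs'
    simp only [hA', Finset.mem_map, Equiv.coe_toEmbedding, Equiv.coe_addRight] at hs'
    obtain ⟨s', hs', rfl⟩ := hs'
    simp only [hA, Finset.mem_filter, Finset.mem_univ, true_and] at hs hs'
    obtain ⟨i, hi⟩ := hs
    obtain ⟨i', hi'⟩ := hs'
    exact hi'.not_succ hi
  have hcard : (A ∪ A').card = 2 * A.card := by
    rw [Finset.card_union_of_disjoint hdisj, hA', Finset.card_map]; ring
  have huniv : (Finset.univ : Finset (ZMod (2 * l))).card = 2 * l := by
    rw [Finset.card_univ, ZMod.card]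
  rcases B.eq_empty_or_nonempty with hBe | ⟨s, hs⟩
  · have := Finset.card_le_card (Finset.subset_univ (A ∪ A'))
    rw [hBe, Finset.card_empty]
    omega
  · have hs' : LongGapAt l R s := by simpa [hB] using hs
    have hout : s + 1 ∉ A ∪ A' := by
      simp only [hA, hA', Finset.mem_union, Finset.mem_map, Equiv.coe_toEmbedding,
        Equiv.coe_addRight, Finset.mem_filter, Finset.mem_univ, true_and]
      rintro (⟨i, hi⟩ | ⟨s', ⟨i, hi⟩, he⟩)
      · exact hs'.not_firstAtOdd_succ hl hi
      · rw [add_right_cancel he] at hi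
        exact hs'.not_firstAtOdd hi
    have := Finset.card_lt_card
      (Finset.ssubset_univ_iff.2 fun e : A ∪ A' = Finset.univ =>
        hout (by rw [e]; exact Finset.mem_univ _))
    omega

/-- A random process that picks each term with a subprobability depending on the previous terms
has total mass at most one. -/
theorem sum_prod_conditional_le_one {D : Type*} [Fintype D] (g : ∀ i : ℕ, (Fin i → D) → D → ℝ)
    (g_nonneg : ∀ i p d, 0 ≤ g i p d) (g_sum : ∀ i p, ∑ d, g i p d ≤ 1) (k : ℕ) :
    ∑ t : Fin k → D, ∏ i : Fin k, g i (fun j => t (Fin.castLE i.2.le j)) (t i) ≤ 1 := by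
  induction k with
  | zero => simp
  | succ k ih =>
    rw [← (Fin.snocEquiv (fun _ : Fin (k + 1) => D)).sum_comp, Fintype.sum_prod_type_right]
    refine le_trans (Finset.sum_le_sum fun t _ => ?_) ih
    have hsnoc : ∀ d : D, ∏ i : Fin (k + 1),
        g i (fun j => Fin.snocEquiv (fun _ : Fin (k + 1) => D) (d, t) (Fin.castLE i.2.le j))
          (Fin.snocEquiv (fun _ : Fin (k + 1) => D) (d, t) i) =
        (∏ i : Fin k, g i (fun j => t (Fin.castLE i.2.le j)) (t i)) * g k t d := by
      intro d
      rw [Fin.prod_univ_castSucc]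
      congr 1
      · refine Finset.prod_congr rfl fun i _ => ?_
        simp only [Fin.snocEquiv, Equiv.coe_fn_mk, Fin.snoc_castSucc, Fin.val_castSucc]
        congr 1
        funext j
        exact Fin.snoc_castSucc (α := fun _ => D) d t (Fin.castLE i.2.le j)
      · simp only [Fin.snocEquiv, Equiv.coe_fn_mk, Fin.snoc_last, Fin.val_last]
        congr 1
        funext j
        exact Fin.snoc_castSucc (α := fun _ => D) d t j
    rw [Finset.sum_congr rfl fun d _ => hsnoc d, ← Finset.mul_sum]
    exact mul_le_of_le_one_right (Finset.prod_nonneg fun i _ => g_nonneg _ _ _) (g_sum k t)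

theorem one_sub_sum_le_prod_inv {ι : Type*} (I : Finset ι) (b : ι → ℝ) (hb : ∀ i ∈ I, 0 < b i) :
    1 - ∑ i ∈ I, (b i - 1) ≤ ∏ i ∈ I, (b i)⁻¹ := by
  have hprod : ∏ i ∈ I, (b i)⁻¹ = Real.exp (-∑ i ∈ I, Real.log (b i)) := by
    rw [← Finset.sum_neg_distrib, Real.exp_sum]
    exact Finset.prod_congr rfl fun i hi => by rw [Real.exp_neg, Real.exp_log (hb i hi)]
  have hlog : ∑ i ∈ I, Real.log (b i) ≤ ∑ i ∈ I, (b i - 1) :=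
    Finset.sum_le_sum fun i hi => Real.log_le_sub_one_of_pos (hb i hi)
  rw [hprod]
  linarith [Real.add_one_le_exp (-∑ i ∈ I, Real.log (b i))]

theorem IsInducedCycle.adj_natCast {V : Type*} {G : SimpleGraph V} {n : ℕ} {c : ZMod n → V}
    (hc : IsInducedCycle G c) {a b : ℕ} (hba : b < a) (han : a < n) :
    G.Adj (c a) (c b) ↔ a = b + 1 ∨ (b = 0 ∧ a + 1 = n) := by
  rw [hc.2]
  have e₁ : (a : ZMod n) = b + 1 ↔ a = b + 1 := by
    rw [show (b : ZMod n) + 1 = ((b + 1 : ℕ) : ZMod n) by push_cast; rfl,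
      ZMod.natCast_eq_natCast_iff', Nat.mod_eq_of_lt han, Nat.mod_eq_of_lt (by omega)]
  have e₂ : (b : ZMod n) = a + 1 ↔ b = 0 ∧ a + 1 = n := by
    rw [show (a : ZMod n) + 1 = ((a + 1 : ℕ) : ZMod n) by push_cast; rfl,
      ZMod.natCast_eq_natCast_iff', Nat.mod_eq_of_lt (hba.trans han)]
    rcases Nat.lt_or_ge (a + 1) n with h | h
    · rw [Nat.mod_eq_of_lt h]; omega
    · have : a + 1 = n := by omega
      rw [this, Nat.mod_self]; omega
  rw [e₁, e₂]

theorem IsInducedCycle.matchingDart_mem_extensions {V : Type*} [Fintype V] {G : SimpleGraph V}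
    {l : ℕ} {c : ZMod (2 * l) → V} (hc : IsInducedCycle G c) {i : ℕ} (hi : i < l) :
    matchingDart c i ∈ extensions G l i (fun j => matchingDart c j) := by
  classical
  rw [extensions, Finset.mem_filter]
  simp only [matchingDart]
  refine ⟨Finset.mem_univ _, ((hc.adj_natCast (by omega) (by omega)).2 (Or.inl rfl)).symm,
    fun j => ?_⟩
  have hj := j.2
  rw [hc.adj_natCast (by omega) (by omega), hc.adj_natCast (by omega) (by omega),
    hc.adj_natCast (by omega) (by omega), hc.adj_natCast (by omega) (by omega)]
  omega

theorem IsInducedCycle.rotate {V : Type*} {G : SimpleGraph V} {n : ℕ} {c : ZMod n → V}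
    (hc : IsInducedCycle G c) (s : ZMod n) : IsInducedCycle G (fun t => c (s + t)) := by
  refine ⟨fun a b h => add_left_cancel (hc.1 h), fun i j => ?_⟩
  rw [hc.2, add_assoc, add_assoc, add_right_inj, add_right_inj]

theorem IsInducedCycle.reflect {V : Type*} {G : SimpleGraph V} {n : ℕ} {c : ZMod n → V}
    (hc : IsInducedCycle G c) : IsInducedCycle G (fun t => c (-t)) := by
  refine ⟨fun a b h => neg_injective (hc.1 h), fun i j => ?_⟩
  rw [hc.2, or_comm]
  refine or_congr ⟨fun h => ?_, fun h => ?_⟩ ⟨fun h => ?_, fun h => ?_⟩ <;> grind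

theorem matchingDart_injective {V : Type*} {l : ℕ} [NeZero (2 * l)] :
    Function.Injective fun (c : ZMod (2 * l) → V) (i : Fin l) => matchingDart c i := by
  intro c c' h
  funext t
  have ht := ZMod.val_lt t
  rw [← ZMod.natCast_zmod_val t]
  obtain ⟨j, hj | hj⟩ := Nat.even_or_odd' t.val
  · rw [hj]
    exact congrArg Prod.fst (congrFun h ⟨j, by omega⟩)
  · rw [hj]
    exact congrArg Prod.snd (congrFun h ⟨j, by omega⟩)

open Classical in
theorem sum_card_extensions_le {V : Type*} [Fintype V] (G : SimpleGraph V) {l : ℕ} (hl : 4 ≤ l)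
    [NeZero (2 * l)] (c : ZMod (2 * l) → V) :
    2 * ∑ s, ∑ i ∈ Finset.Ico 1 l,
      (extensions G l i (fun j => matchingDart (fun t => c (s + t)) j)).card ≤
      l * (Finset.univ.filter fun d : V × V => G.Adj d.1 d.2).card := by
  set E := Finset.univ.filter fun d : V × V => G.Adj d.1 d.2 with hE
  set F : V × V → ℕ := fun d =>
    (((Finset.univ : Finset (ZMod (2 * l))) ×ˢ Finset.Ico 1 l).filter fun a =>
      IsExtensionAt l (fun t => G.Adj d.1 (c t)) (fun t => G.Adj d.2 (c t)) a.1 a.2).card with hF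
  have hcount : ∑ s, ∑ i ∈ Finset.Ico 1 l,
      (extensions G l i (fun j => matchingDart (fun t => c (s + t)) j)).card = ∑ d ∈ E, F d := by
    rw [← Finset.sum_product (f := fun a : ZMod (2 * l) × ℕ =>
      (extensions G l a.2 (fun j => matchingDart (fun t => c (a.1 + t)) j)).card)]
    simp only [hF]
    refine Eq.trans (Finset.sum_congr rfl fun a _ => ?_)
      (Finset.sum_card_bipartiteAbove_eq_sum_card_bipartiteBelow (s := E)
        (t := Finset.univ ×ˢ Finset.Ico 1 l)
        (fun (d : V × V) (a : ZMod (2 * l) × ℕ) => IsExtensionAt l (fun t => G.Adj d.1 (c t))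
          (fun t => G.Adj d.2 (c t)) a.1 a.2)).symm
    congr 1
    ext d
    simp only [extensions, matchingDart, IsExtensionAt, Finset.bipartiteBelow, hE,
      Finset.mem_filter, Finset.mem_univ, true_and, Fin.forall_iff]
  have hswap : ∑ d ∈ E, F d = ∑ d ∈ E, F d.swap := by
    refine Finset.sum_equiv (Equiv.prodComm V V) (fun d => ?_) (fun d _ => by simp)
    simp [hE, G.adj_comm]
  rw [hcount, two_mul]
  nth_rewrite 2 [hswap]
  rw [← Finset.sum_add_distrib, mul_comm, ← smul_eq_mul, ← Finset.sum_const]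
  exact Finset.sum_le_sum fun d _ => card_isExtensionAt_le hl _ _

open Classical in
theorem sum_weight_le_one {V : Type*} [Fintype V] (G : SimpleGraph V) (l : ℕ) [NeZero (2 * l)] :
    ∑ c : ZMod (2 * l) → V with IsInducedCycle G c,
      ∏ i ∈ Finset.range l, ((extensions G l i (fun j => matchingDart c j)).card : ℝ)⁻¹ ≤ 1 := by
  set g : ∀ i : ℕ, (Fin i → V × V) → V × V → ℝ := fun i p d =>
    if d ∈ extensions G l i p then ((extensions G l i p).card : ℝ)⁻¹ else 0 with hg
  have g_nonneg : ∀ i p d, 0 ≤ g i p d := fun i p d => by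
    simp only [hg]; split_ifs <;> positivity
  have g_sum : ∀ i p, ∑ d, g i p d ≤ 1 := fun i p => by
    simp only [hg, Finset.sum_ite_mem, Finset.univ_inter, Finset.sum_const, nsmul_eq_mul]
    exact mul_inv_le_one
  refine le_trans ?_ (sum_prod_conditional_le_one g g_nonneg g_sum l)
  refine le_trans (le_of_eq ?_) (Finset.sum_le_sum_of_subset_of_nonneg
    (Finset.subset_univ ((Finset.univ.filter fun c : ZMod (2 * l) → V =>
      IsInducedCycle G c).image fun c (i : Fin l) => matchingDart c i))
    fun t _ _ => Finset.prod_nonneg fun i _ => g_nonneg _ _ _)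
  rw [Finset.sum_image fun c _ c' _ h => matchingDart_injective h]
  refine Finset.sum_congr rfl fun c hc => ?_
  rw [Finset.prod_range]
  refine Finset.prod_congr rfl fun i _ => ?_
  exact (if_pos ((Finset.mem_filter.1 hc).2.matchingDart_mem_extensions i.2)).symm

open Classical in
theorem card_filter_adj {V : Type*} [Fintype V] (G : SimpleGraph V) :
    (Finset.univ.filter fun d : V × V => G.Adj d.1 d.2).card = 2 * G.edgeSet.ncard := by
  rw [Set.ncard_eq_toFinset_card', ← SimpleGraph.edgeFinset, G.two_mul_card_edgeFinset]

/-- AM-GM: if the average of the `a s i` is at most `A`, then the average over `s` of the products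
`∏ i, (a s i)⁻¹` is at least what it is when all `a s i` equal `A`. -/
theorem card_mul_inv_pow_le_sum_prod_inv {ι κ : Type*} (T : Finset ι) (I : Finset κ)
    (a : ι → κ → ℝ) {A : ℝ} (hA : 0 < A) (ha : ∀ s ∈ T, ∀ i ∈ I, 0 < a s i)
    (hsum : ∑ s ∈ T, ∑ i ∈ I, a s i ≤ T.card * I.card * A) :
    T.card * (A ^ I.card)⁻¹ ≤ ∑ s ∈ T, ∏ i ∈ I, (a s i)⁻¹ := by
  have hmean : (T.card : ℝ) ≤ ∑ s ∈ T, ∏ i ∈ I, (a s i / A)⁻¹ := by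
    refine le_trans ?_ (Finset.sum_le_sum fun s hs =>
      one_sub_sum_le_prod_inv I (fun i => a s i / A) fun i hi => div_pos (ha s hs i hi) hA)
    simp only [Finset.sum_sub_distrib, Finset.sum_const, nsmul_eq_mul, mul_one, ← Finset.sum_div]
    have hdiv := (div_le_iff₀ hA).2 hsum
    linarith
  calc T.card * (A ^ I.card)⁻¹
      ≤ (∑ s ∈ T, ∏ i ∈ I, (a s i / A)⁻¹) * (A ^ I.card)⁻¹ := by gcongr
    _ = _ := by
      rw [Finset.sum_mul]
      refine Finset.sum_congr rfl fun s _ => ?_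
      simp only [inv_div, Finset.prod_div_distrib, Finset.prod_const, Finset.prod_inv_distrib]
      rw [div_eq_mul_inv, mul_right_comm, mul_inv_cancel₀ (pow_ne_zero _ hA.ne'), one_mul]

theorem IsInducedCycle.le_sum_weight_rotate {V : Type*} [Fintype V] {G : SimpleGraph V} {l : ℕ}
    (hl : 4 ≤ l) [NeZero (2 * l)] {c : ZMod (2 * l) → V} (hc : IsInducedCycle G c)
    (hm : 0 < G.edgeSet.ncard) :
    2 * l * (((G.edgeSet.ncard : ℝ) / (2 * (l - 1))) ^ (l - 1))⁻¹ ≤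
      ∑ s, ∏ i ∈ Finset.Ico 1 l,
        ((extensions G l i (fun j => matchingDart (fun t => c (s + t)) j)).card : ℝ)⁻¹ := by
  have hsum := sum_card_extensions_le G hl c
  rw [card_filter_adj] at hsum
  have hl' : (0 : ℝ) < l - 1 := by
    have : (4 : ℝ) ≤ l := by exact_mod_cast hl
    linarith
  have hm' : (0 : ℝ) < G.edgeSet.ncard := by exact_mod_cast hm
  have hcardI : ((Finset.Ico 1 l).card : ℝ) = l - 1 := by
    rw [Nat.card_Ico, Nat.cast_sub (by omega), Nat.cast_one]
  have hcardT : ((Finset.univ : Finset (ZMod (2 * l))).card : ℝ) = 2 * l := by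
    rw [Finset.card_univ, ZMod.card]; push_cast; rfl
  have key := card_mul_inv_pow_le_sum_prod_inv (Finset.univ : Finset (ZMod (2 * l)))
    (Finset.Ico 1 l)
    (fun s i => ((extensions G l i (fun j => matchingDart (fun t => c (s + t)) j)).card : ℝ))
    (A := (G.edgeSet.ncard : ℝ) / (2 * (l - 1))) (by positivity)
    (fun s _ i hi => by
      exact_mod_cast Finset.card_pos.2
        ⟨_, (hc.rotate s).matchingDart_mem_extensions (Finset.mem_Ico.1 hi).2⟩)
    (by
      have h : (2 : ℝ) * ∑ s, ∑ i ∈ Finset.Ico 1 l,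
          ((extensions G l i (fun j => matchingDart (fun t => c (s + t)) j)).card : ℝ) ≤
          l * (2 * G.edgeSet.ncard) := by exact_mod_cast hsum
      have e : (2 * l * (l - 1) * ((G.edgeSet.ncard : ℝ) / (2 * (l - 1))) : ℝ) =
          l * G.edgeSet.ncard := by field_simp
      rw [hcardI, hcardT, e]
      linarith)
  rwa [hcardT, Nat.card_Ico] at key

open Classical in
theorem card_isInducedCycle_le {V : Type*} [Fintype V] (G : SimpleGraph V) {l : ℕ} (hl : 4 ≤ l)
    [NeZero (2 * l)] (hm : 0 < G.edgeSet.ncard) :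
    ((Finset.univ.filter fun c : ZMod (2 * l) → V => IsInducedCycle G c).card : ℝ) ≤
      2 * G.edgeSet.ncard * ((G.edgeSet.ncard : ℝ) / (2 * (l - 1))) ^ (l - 1) := by
  set E := Finset.univ.filter fun c : ZMod (2 * l) → V => IsInducedCycle G c with hE
  set w : (ZMod (2 * l) → V) → ℝ := fun c => ∏ i ∈ Finset.Ico 1 l,
    ((extensions G l i (fun j => matchingDart c j)).card : ℝ)⁻¹ with hw
  have hbound := fun c (hc : c ∈ E) => (Finset.mem_filter.1 hc).2.le_sum_weight_rotate hl hm
  have htotal := sum_weight_le_one G l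
  have hfirst : ∀ c : ZMod (2 * l) → V,
      (extensions G l 0 (fun j => matchingDart c j)).card = 2 * G.edgeSet.ncard := fun c => by
    rw [← card_filter_adj]
    simp [extensions]
  simp only [Finset.prod_range_eq_mul_Ico _ (show 0 < l by omega), hfirst, ← Finset.mul_sum]
    at htotal
  set m := G.edgeSet.ncard
  have hl' : (0 : ℝ) < l - 1 := by
    have : (4 : ℝ) ≤ l := by exact_mod_cast hl
    linarith
  have hm' : (0 : ℝ) < m := by exact_mod_cast hm
  set A : ℝ := m / (2 * (l - 1)) with hA
  have hApos : 0 < A := by positivity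
  have hrot : ∀ s : ZMod (2 * l), ∑ c ∈ E, w (fun t => c (s + t)) = ∑ c ∈ E, w c := fun s => by
    refine Finset.sum_equiv ((Equiv.addLeft s).symm.arrowCongr (Equiv.refl V)) (fun c => ?_)
      (fun c _ => rfl)
    simp only [hE, Finset.mem_filter, Finset.mem_univ, true_and]
    refine ⟨fun h => h.rotate s, fun h => ?_⟩
    convert IsInducedCycle.rotate h (-s) using 2 with t
    simp
  have hsum : (E.card : ℝ) * (2 * l * (A ^ (l - 1))⁻¹) ≤ 2 * l * ∑ c ∈ E, w c := by
    calc (E.card : ℝ) * (2 * l * (A ^ (l - 1))⁻¹)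
        = ∑ c ∈ E, 2 * l * (A ^ (l - 1))⁻¹ := by rw [Finset.sum_const, nsmul_eq_mul]
      _ ≤ ∑ c ∈ E, ∑ s, w (fun t => c (s + t)) := Finset.sum_le_sum hbound
      _ = ∑ s : ZMod (2 * l), ∑ c ∈ E, w c := by
        rw [Finset.sum_comm]; exact Finset.sum_congr rfl fun s _ => hrot s
      _ = 2 * l * ∑ c ∈ E, w c := by
        rw [Finset.sum_const, nsmul_eq_mul, Finset.card_univ, ZMod.card]; push_cast; ring
  have hw_le : ∑ c ∈ E, w c ≤ 2 * m := by
    have := (inv_mul_le_iff₀ (by positivity)).1 htotal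
    push_cast at this
    linarith
  have hlpos : (0 : ℝ) < 2 * l := by linarith
  have hE_le : (E.card : ℝ) * (A ^ (l - 1))⁻¹ ≤ 2 * m := by
    refine le_trans (le_of_mul_le_mul_left ?_ hlpos) hw_le
    linarith
  exact (mul_inv_le_iff₀ (by positivity)).1 hE_le

theorem exists_equiv_cycleGraph_adj {n : ℕ} (hn : 2 ≤ n) :
    ∃ e : Fin n ≃ ZMod n, ∀ i j, (cycleGraph n).Adj i j ↔ e i = e j + 1 ∨ e j = e i + 1 := by
  obtain ⟨k, rfl⟩ := Nat.exists_eq_add_of_le' hn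
  refine ⟨Equiv.refl (Fin (k + 2)), fun i j => ?_⟩
  rw [cycleGraph_adj]
  exact or_congr sub_eq_iff_eq_add' sub_eq_iff_eq_add'

theorem exists_isInducedCycle_range_eq {V : Type*} {G : SimpleGraph V} {n : ℕ} (hn : 2 ≤ n)
    {S : Finset V} (h : Nonempty ((G.induce (S : Set V)) ≃g cycleGraph n)) :
    ∃ c : ZMod n → V, IsInducedCycle G c ∧ Set.range c = S := by
  obtain ⟨φ⟩ := h
  obtain ⟨e, he⟩ := exists_equiv_cycleGraph_adj hn
  refine ⟨fun t => (φ.symm (e.symm t)).1, ⟨fun a b hab => ?_, fun i j => ?_⟩, ?_⟩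
  · exact e.symm.injective (φ.symm.injective (Subtype.ext hab))
  · have := he (e.symm i) (e.symm j)
    rw [e.apply_symm_apply, e.apply_symm_apply, ← φ.symm.map_adj_iff] at this
    exact this
  · ext v
    constructor
    · rintro ⟨t, rfl⟩
      exact (φ.symm (e.symm t)).2
    · intro hv
      exact ⟨e (φ ⟨v, hv⟩), by simp⟩

open Classical in
theorem four_mul_inducedCopies_le {V : Type*} [Fintype V] (G : SimpleGraph V) {l : ℕ}
    (hl : 4 ≤ l) [NeZero (2 * l)] :
    4 * l * inducedCopies G (cycleGraph (2 * l)) ≤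
      (Finset.univ.filter fun c : ZMod (2 * l) → V => IsInducedCycle G c).card := by
  rw [inducedCopies, Set.ncard_eq_toFinset_card']
  set 𝒮 := {S : Finset V | Nonempty ((G.induce (S : Set V)) ≃g cycleGraph (2 * l))}.toFinset
    with h𝒮
  have hmem : ∀ S ∈ 𝒮, Nonempty ((G.induce (S : Set V)) ≃g cycleGraph (2 * l)) := fun S hS => by
    simpa [h𝒮] using hS
  rcases 𝒮.eq_empty_or_nonempty with hempty | ⟨S₀, hS₀⟩
  · simp [hempty]
  have : Nonempty V := by
    obtain ⟨c, -⟩ := exists_isInducedCycle_range_eq (by omega) (hmem S₀ hS₀)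
    exact ⟨c 0⟩
  choose! cyc hcyc hrange using fun (S : Finset V)
    (h : Nonempty ((G.induce (S : Set V)) ≃g cycleGraph (2 * l))) =>
      exists_isInducedCycle_range_eq (by omega) h
  have hcard : (𝒮 ×ˢ (Finset.univ : Finset (ZMod (2 * l) × Bool))).card = 4 * l * 𝒮.card := by
    rw [Finset.card_product, Finset.card_univ, Fintype.card_prod, ZMod.card, Fintype.card_bool]
    ring
  rw [← hcard]
  refine Finset.card_le_card_of_injOn
    (fun a t => cyc a.1 (a.2.1 + if a.2.2 then t else -t)) ?_ ?_
  · rintro ⟨S, s, b⟩ ha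
    have hS := hcyc S (hmem S (Finset.mem_product.1 ha).1)
    simp only [Finset.coe_filter, Finset.mem_univ, true_and, Set.mem_ofPred_eq]
    cases b
    · simpa using (hS.rotate s).reflect
    · simpa using hS.rotate s
  · rintro ⟨S, s, b⟩ ha ⟨S', s', b'⟩ ha' heq
    have hS := hmem S (Finset.mem_product.1 ha).1
    have hS' := hmem S' (Finset.mem_product.1 ha').1
    have hrng : ∀ (T : Finset V) (s : ZMod (2 * l)) (b : Bool),
        Set.range (fun t => cyc T (s + if b then t else -t)) = Set.range (cyc T) := by
      intro T s b
      refine Function.Surjective.range_comp (f := fun t => s + if b then t else -t)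
        (fun t => ?_) (cyc T)
      cases b
      · exact ⟨s - t, by simp⟩
      · exact ⟨t - s, by simp⟩
    obtain rfl : S = S' := by
      have := congrArg Set.range heq
      simp only [hrng, hrange S hS, hrange S' hS'] at this
      exact_mod_cast this
    have hval := fun t => (hcyc S hS).1 (congrFun heq t)
    obtain rfl : s = s' := by simpa using hval 0
    have htwo : (1 : ZMod (2 * l)) ≠ -1 := by
      intro h
      have h2 : ((2 : ℕ) : ZMod (2 * l)) = 0 := by
        push_cast
        linear_combination h
      rw [ZMod.natCast_eq_zero_iff] at h2
      have := Nat.le_of_dvd (by norm_num) h2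
      omega
    have hb := hval 1
    cases b <;> cases b'
    · rfl
    · exact absurd (add_left_cancel hb).symm htwo
    · exact absurd (add_left_cancel hb) htwo
    · rfl

theorem even_cycle_upper_bound (l : ℕ) (hl : 4 ≤ l) {V : Type*} [Fintype V]
    (G : SimpleGraph V) (m : ℕ) (hG : G.edgeSet.ncard = m) :
    (inducedCopies G (SimpleGraph.cycleGraph (2 * l)) : ℝ) ≤
      ((m : ℝ) / (2 * (l : ℝ))) ^ l * (1 + 1 / ((l : ℝ) - 1)) ^ (l - 1) ∧
    (inducedCopies G (SimpleGraph.cycleGraph (2 * l)) : ℝ) ≤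
      Real.exp 1 * ((m : ℝ) / (2 * (l : ℝ))) ^ l := by
  classical
  have : NeZero (2 * l) := ⟨by omega⟩
  have hl4 : (4 : ℝ) ≤ l := by exact_mod_cast hl
  have hl' : (0 : ℝ) < l - 1 := by linarith
  have hlpos : (0 : ℝ) < l := by linarith
  have hcopies := four_mul_inducedCopies_le G hl
  have main : (inducedCopies G (SimpleGraph.cycleGraph (2 * l)) : ℝ) ≤
      ((m : ℝ) / (2 * (l : ℝ))) ^ l * (1 + 1 / ((l : ℝ) - 1)) ^ (l - 1) := by
    rcases Nat.eq_zero_or_pos m with hm | hm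
    · have hempty : (Finset.univ.filter fun c : ZMod (2 * l) → V => IsInducedCycle G c) = ∅ := by
        rw [Finset.filter_eq_empty_iff]
        intro c _ hc
        have hadj : G.Adj (c 1) (c 0) := (hc.2 1 0).2 (Or.inl (zero_add 1).symm)
        rw [hm, Set.ncard_eq_zero] at hG
        have : s(c 1, c 0) ∈ G.edgeSet := hadj
        simp [hG] at this
      rw [hempty, Finset.card_empty] at hcopies
      have : inducedCopies G (SimpleGraph.cycleGraph (2 * l)) = 0 := by
        have h := Nat.eq_zero_of_le_zero hcopies
        rcases Nat.mul_eq_zero.1 h with h | h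
        · omega
        · exact h
      rw [this, Nat.cast_zero]
      positivity
    · have hcycles := card_isInducedCycle_le G hl (hG ▸ hm)
      rw [hG] at hcycles
      have hle : (4 * l * inducedCopies G (SimpleGraph.cycleGraph (2 * l)) : ℝ) ≤
          2 * m * ((m : ℝ) / (2 * (l - 1))) ^ (l - 1) :=
        le_trans (by exact_mod_cast hcopies) hcycles
      have hbase : (m : ℝ) / (2 * l) * (1 + 1 / (l - 1)) = m / (2 * (l - 1)) := by
        field_simp
        ring
      have hpow : ((m : ℝ) / (2 * (l : ℝ))) ^ l = (m / (2 * l)) ^ (l - 1) * (m / (2 * l)) := by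
        rw [← pow_succ, Nat.sub_add_cancel (by omega)]
      rw [hpow, mul_right_comm, ← mul_pow, hbase, ← mul_div_assoc, le_div_iff₀ (by positivity)]
      linarith
  refine ⟨main, main.trans ?_⟩
  rw [mul_comm (Real.exp 1)]
  gcongr
  calc (1 + 1 / ((l : ℝ) - 1)) ^ (l - 1) ≤ Real.exp (1 / ((l : ℝ) - 1)) ^ (l - 1) := by
        gcongr
        linarith [Real.add_one_le_exp (1 / ((l : ℝ) - 1))]
    _ = Real.exp 1 := by
        rw [← Real.exp_nat_mul, Nat.cast_sub (by omega), Nat.cast_one, mul_one_div_cancel hl'.ne']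
end
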